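/- arXiv:2507.16883 — 4 statements merged into one kernel-verified Lean document; each statement's English description precedes it below -/
import Mathlib

section
/- Let p be an odd rational prime and let a, b be coprime integers. If p divides a² + 3b², then there exist integers x, y such that p = x² + 3y². -/
/-- **Thue's lemma**: every residue class modulo `n` is a quotient of integers bounded by `√n`. -/
theorem ZMod.exists_intCast_eq_mul_intCast_sq_le (n : ℕ) [NeZero n] (c : ZMod n) :
    ∃ x y : ℤ, (x ≠ 0 ∨ y ≠ 0) ∧ x ^ 2 ≤ n ∧ y ^ 2 ≤ n ∧ (x : ZMod n) = c * y := by
  have hcard : Fintype.card (ZMod n) <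
      Fintype.card (Fin (n.sqrt + 1) × Fin (n.sqrt + 1)) := by
    simpa [ZMod.card] using n.lt_succ_sqrt
  obtain ⟨⟨u, v⟩, ⟨u', v'⟩, hne, heq⟩ := Fintype.exists_ne_map_eq_of_card_lt
    (fun w : Fin (n.sqrt + 1) × Fin (n.sqrt + 1) ↦
      ((w.1 : ℕ) : ZMod n) - c * ((w.2 : ℕ) : ZMod n)) hcard
  have hbound (i j : Fin (n.sqrt + 1)) : ((i : ℤ) - j) ^ 2 ≤ n := by
    have hs : (n.sqrt : ℤ) ^ 2 ≤ n := by exact_mod_cast n.sqrt_le'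
    refine (sq_le_sq' ?_ ?_).trans hs <;> omega
  refine ⟨(u : ℤ) - u', (v : ℤ) - v', ?_, hbound u u', hbound v v', ?_⟩
  · by_contra! h
    exact hne (Prod.ext (Fin.ext (by lia)) (Fin.ext (by lia)))
  · push_cast
    linear_combination heq

/-- If `p` is an odd prime and `a, b` are coprime integers with
`p ∣ a² + 3b²`, then `p` is of the form `x² + 3y²`. -/
theorem prime_dvd_sq_add_three_sq (p : ℕ) (hp : p.Prime) (hpodd : Odd p)
    (a b : ℤ) (hab : IsCoprime a b) (hdvd : (p : ℤ) ∣ a ^ 2 + 3 * b ^ 2) :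
    ∃ x y : ℤ, (p : ℤ) = x ^ 2 + 3 * y ^ 2 := by
  have : Fact p.Prime := ⟨hp⟩
  have hpz : Prime (p : ℤ) := Nat.prime_iff_prime_int.mp hp
  have hb : (b : ZMod p) ≠ 0 := by
    rw [Ne, ZMod.intCast_zmod_eq_zero_iff_dvd]
    intro hpb
    have hpa : (p : ℤ) ∣ a := hpz.dvd_of_dvd_pow
      ((dvd_add_left ((hpb.pow two_ne_zero).mul_left 3)).mp hdvd)
    exact hpz.not_isUnit (hab.isUnit_of_dvd' hpa hpb)
  have hc : (a / b : ZMod p) ^ 2 = -3 := by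
    have h : (a : ZMod p) ^ 2 + 3 * (b : ZMod p) ^ 2 = 0 := by
      exact_mod_cast (ZMod.intCast_zmod_eq_zero_iff_dvd _ p).mpr hdvd
    field_simp
    linear_combination h
  obtain ⟨x, y, hne, hx, hy, hxy⟩ := ZMod.exists_intCast_eq_mul_intCast_sq_le p (a / b : ZMod p)
  have hlt {z : ℤ} (hz : z ^ 2 ≤ p) : z ^ 2 < p :=
    hz.lt_of_ne fun h ↦ hpz.irreducible.not_isSquare ⟨z, by rw [← h, sq]⟩
  obtain ⟨k, hk⟩ : (p : ℤ) ∣ x ^ 2 + 3 * y ^ 2 := by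
    rw [← ZMod.intCast_zmod_eq_zero_iff_dvd]
    push_cast
    rw [hxy, mul_pow, hc]
    ring
  have hppos : (0 : ℤ) < p := by exact_mod_cast hp.pos
  have hpos : 0 < x ^ 2 + 3 * y ^ 2 := by
    rcases hne with h | h <;> positivity
  have hk0 : 0 < k := pos_of_mul_pos_right (hk ▸ hpos) hppos.le
  have hk4 : k < 4 := by
    refine lt_of_mul_lt_mul_left ?_ hppos.le
    linarith [hlt hx, hlt hy]
  interval_cases k
  · exact ⟨x, y, by linarith⟩
  · exfalso
    obtain ⟨m, hm⟩ := hpodd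
    subst hm
    push_cast at hk
    rcases Int.even_or_odd' x with ⟨s, rfl | rfl⟩ <;>
      rcases Int.even_or_odd' y with ⟨t, rfl | rfl⟩ <;> ring_nf at hk <;> omega
  · obtain ⟨z, rfl⟩ : (3 : ℤ) ∣ x :=
      Int.prime_three.dvd_of_dvd_pow (n := 2) ⟨p - y ^ 2, by linarith⟩
    exact ⟨y, z, by linarith⟩
end

section
/- Let K be a totally real number field and L a quadratic extension of K containing an element s with s² = −3 (so L = K(√−3)). Then the class number h(K) divides the class number h(L). -/
open NumberField

section LatticeSum

open MeasureTheory Module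

theorem exists_bound_abs_tsum_lattice {E ι : Type*} [NormedAddCommGroup E] [NormedSpace ℝ E]
    [FiniteDimensional ℝ E] [MeasurableSpace E] [BorelSpace E] (μ : Measure E)
    [μ.IsAddHaarMeasure] [Fintype ι] (b : Basis ι ℝ E) (c : E) (R : ℝ) :
    ∃ C : ℝ, ∀ (L : NNReal) (H : E → ℝ), LipschitzWith L H → (∀ x, R < ‖x‖ → H x = 0) →
      ∫ x, H x ∂μ = 0 → ∀ t : ℝ, 0 < t →
        |∑' m : ι → ℤ, H (t⁻¹ • (c + ∑ i, (m i : ℝ) • b i))| ≤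
          C * L * (1 + t) ^ Fintype.card ι / t := by
  classical
  set D := ZSpan.fundamentalDomain b with hD
  obtain ⟨δ, hδ⟩ := (ZSpan.fundamentalDomain_isBounded b).exists_norm_le
  have hDm : MeasurableSet D := ZSpan.fundamentalDomain_measurableSet b
  have hDfin : μ D < ⊤ := (ZSpan.fundamentalDomain_isBounded b).measure_lt_top
  set ν := μ.real D with hν
  have hνpos : 0 < ν := by
    rw [hν, measureReal_def, ENNReal.toReal_pos_iff]
    exact ⟨pos_iff_ne_zero.mpr (ZSpan.measure_fundamentalDomain_ne_zero b), hDfin⟩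
  have hδ0 : 0 ≤ δ := by
    have h0 : (0 : E) ∈ D := by
      rw [hD, ZSpan.mem_fundamentalDomain]; intro i; simp
    simpa using hδ 0 h0
  let P : (ι → ℤ) → E := fun m ↦ ∑ i, (m i : ℝ) • b i
  set κ := ‖(b.equivFunL : E →L[ℝ] (ι → ℝ))‖ with hκ
  have hκ0 : 0 ≤ κ := norm_nonneg _
  have hcoord (m : ι → ℤ) (i : ι) : |(m i : ℝ)| ≤ κ * ‖P m‖ := by
    have h1 : b.equivFunL (P m) = fun i ↦ (m i : ℝ) := by
      have : b.equivFunL (P m) = b.equivFun (b.equivFun.symm fun i ↦ (m i : ℝ)) := by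
        rw [b.equivFun_symm_apply]
        rfl
      rw [this, LinearEquiv.apply_symm_apply]
    have h2 := (b.equivFunL : E →L[ℝ] (ι → ℝ)).le_opNorm (P m)
    have h3 := norm_le_pi_norm (b.equivFunL (P m)) i
    rw [h1] at h3
    rw [ContinuousLinearEquiv.coe_coe, h1] at h2
    exact h3.trans h2
  set A := 2 * κ * (|R| + δ + ‖c‖) + 1 with hA
  have hA0 : 0 ≤ A := by positivity
  refine ⟨δ * A ^ Fintype.card ι, fun L H hL hsupp hint t ht ↦ ?_⟩
  set h : E → ℝ := fun x ↦ H (t⁻¹ • (c + x)) with hh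
  have hLh (x z : E) : |h (x + z) - h x| ≤ L * (t⁻¹ * ‖z‖) := by
    have := hL.dist_le_mul (t⁻¹ • (c + (x + z))) (t⁻¹ • (c + x))
    rw [dist_eq_norm, dist_eq_norm, ← smul_sub, norm_smul, Real.norm_eq_abs, Real.norm_eq_abs,
      abs_of_pos (inv_pos.mpr ht), add_sub_add_left_eq_sub, add_sub_cancel_left] at this
    exact this
  have hzero (x : E) (hx : t * R < ‖c + x‖) : h x = 0 := by
    apply hsupp
    rw [norm_smul, Real.norm_eq_abs, abs_of_pos (inv_pos.mpr ht), lt_inv_mul_iff₀ ht]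
    exact hx
  have hcont : Continuous h := by
    have := hL.continuous
    fun_prop
  have hcs : HasCompactSupport h := by
    refine HasCompactSupport.intro (isCompact_closedBall (-c) (t * R)) fun x hx ↦ hzero x ?_
    rw [Metric.mem_closedBall, not_le, dist_eq_norm] at hx
    simpa [add_comm] using hx
  have hinth : Integrable h μ := hcont.integrable_of_hasCompactSupport hcs
  have hint0 : ∫ x, h x ∂μ = 0 := by
    rw [hh, integral_add_left_eq_self (fun x ↦ H (t⁻¹ • x)) c, Measure.integral_comp_smul, hint,
      smul_zero]
  let e : (ι → ℤ) ≃ (Submodule.span ℤ (Set.range b)).toAddSubgroup :=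
    (b.restrictScalars ℤ).equivFun.symm.toEquiv
  have he (m : ι → ℤ) : ((e m : (Submodule.span ℤ (Set.range b)).toAddSubgroup) : E) = P m := by
    have : (e m : E) = ((b.restrictScalars ℤ).equivFun.symm m : E) := rfl
    rw [this, Basis.equivFun_symm_apply]
    simp [P, Int.cast_smul_eq_zsmul]
  have hsum0 : ∑' m : ι → ℤ, ∫ z in D, h (P m + z) ∂μ = 0 := by
    have : Countable (Submodule.span ℤ (Set.range b)).toAddSubgroup := e.symm.injective.countable
    rw [← hint0, (ZSpan.isAddFundamentalDomain' b μ).integral_eq_tsum'' h hinth,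
      ← e.tsum_eq]
    refine tsum_congr fun m ↦ ?_
    congr 1 with z
    rw [← he m]
    rfl
  set S : Finset (ι → ℤ) :=
    Fintype.piFinset fun _ ↦ Finset.Icc (-⌊κ * (t * |R| + δ + ‖c‖)⌋) ⌊κ * (t * |R| + δ + ‖c‖)⌋
    with hS
  have hfar (m : ι → ℤ) (hm : m ∉ S) : t * |R| + δ + ‖c‖ < ‖P m‖ := by
    contrapose! hm
    rw [hS, Fintype.mem_piFinset]
    intro i
    have h1 := (hcoord m i).trans (mul_le_mul_of_nonneg_left hm hκ0)
    rw [abs_le] at h1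
    rw [Finset.mem_Icc]
    constructor
    · rw [neg_le, Int.le_floor]; push_cast; linarith
    · rw [Int.le_floor]; exact h1.2
  have hfar' (m : ι → ℤ) (hm : m ∉ S) (z : E) (hz : ‖z‖ ≤ δ) : h (P m + z) = 0 := by
    apply hzero
    have h1 := hfar m hm
    have h2 : ‖P m‖ ≤ ‖c + (P m + z)‖ + ‖c‖ + ‖z‖ := by
      calc ‖P m‖ = ‖(c + (P m + z)) - c - z‖ := by congr 1; abel
        _ ≤ _ := (norm_sub_le _ _).trans (by gcongr; exact norm_sub_le _ _)
    have h3 : t * R ≤ t * |R| := by gcongr; exact le_abs_self R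
    linarith
  have hs1 : ∑' m, h (P m) = ∑ m ∈ S, h (P m) :=
    tsum_eq_sum fun m hm ↦ by simpa using hfar' m hm 0 (by simpa using hδ0)
  have hs2 : ∑ m ∈ S, ∫ z in D, h (P m + z) ∂μ = 0 := by
    rw [← hsum0]
    refine (tsum_eq_sum fun m hm ↦ ?_).symm
    exact setIntegral_eq_zero_of_forall_eq_zero fun z hz ↦ hfar' m hm z (hδ z hz)
  have hcell (m : ι → ℤ) : |h (P m) * ν - ∫ z in D, h (P m + z) ∂μ| ≤ L * (t⁻¹ * δ) * ν := by
    have h1 : h (P m) * ν - ∫ z in D, h (P m + z) ∂μ = -∫ z in D, (h (P m + z) - h (P m)) ∂μ := by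
      rw [integral_sub]
      · simp [hν, mul_comm]
      · exact (hinth.comp_add_left (P m)).integrableOn
      · exact integrableOn_const hDfin.ne
    rw [h1, abs_neg, ← Real.norm_eq_abs]
    refine norm_setIntegral_le_of_norm_le_const hDfin fun z hz ↦ (hLh _ _).trans ?_
    have := hδ z hz
    have := inv_pos.mpr ht
    gcongr
  have hcard : (S.card : ℝ) ≤ (A * (1 + t)) ^ Fintype.card ι := by
    rw [hS, Fintype.card_piFinset, Finset.prod_const, Finset.card_univ, Nat.cast_pow]
    gcongr
    have hB : (0 : ℤ) ≤ ⌊κ * (t * |R| + δ + ‖c‖)⌋ := Int.floor_nonneg.mpr (by positivity)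
    rw [Int.card_Icc, ← Int.cast_natCast, Int.toNat_of_nonneg (by omega)]
    push_cast
    have := Int.floor_le (κ * (t * |R| + δ + ‖c‖))
    have h4 : 0 ≤ κ * (|R| + t * δ + t * ‖c‖) := by positivity
    rw [hA]
    nlinarith
  have hfinal : |(∑ m ∈ S, h (P m)) * ν| ≤ S.card * (L * (t⁻¹ * δ) * ν) := by
    have h1 : (∑ m ∈ S, h (P m)) * ν = ∑ m ∈ S, (h (P m) * ν - ∫ z in D, h (P m + z) ∂μ) := by
      rw [Finset.sum_sub_distrib, hs2, sub_zero, Finset.sum_mul]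
    rw [h1]
    refine (Finset.abs_sum_le_sum_abs _ _).trans ?_
    rw [← nsmul_eq_mul]
    exact Finset.sum_le_card_nsmul _ _ _ fun m _ ↦ hcell m
  rw [abs_mul, abs_of_pos hνpos, ← mul_assoc] at hfinal
  have hfinal2 := le_of_mul_le_mul_right hfinal hνpos
  change |∑' m, h (P m)| ≤ _
  rw [hs1]
  refine hfinal2.trans ?_
  calc (S.card : ℝ) * (L * (t⁻¹ * δ)) ≤ (A * (1 + t)) ^ Fintype.card ι * (L * (t⁻¹ * δ)) := by
        have := inv_pos.mpr ht
        gcongr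
    _ = _ := by rw [mul_pow]; ring

end LatticeSum

section Weight
open MeasureTheory Module

/-- The tent function, supported on `[-1, 1]`, whose integer translates sum to `1`. -/
noncomputable def tent (y : ℝ) : ℝ := max 0 (1 - |y|)

theorem tent_nonneg (y : ℝ) : 0 ≤ tent y := le_max_left _ _

theorem tent_le_one (y : ℝ) : tent y ≤ 1 :=
  max_le zero_le_one (by linarith [abs_nonneg y])

theorem tent_eq_zero {y : ℝ} (hy : 1 ≤ |y|) : tent y = 0 := max_eq_left (by linarith)

theorem abs_tent_sub_tent_le (y z : ℝ) : |tent y - tent z| ≤ |y - z| := by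
  have h1 : |tent y - tent z| ≤ |(1 - |y|) - (1 - |z|)| := by
    simpa [tent] using abs_max_sub_max_le_max 0 (1 - |y|) 0 (1 - |z|)
  have h2 : (1 - |y|) - (1 - |z|) = |z| - |y| := by ring
  rw [h2] at h1
  rw [abs_sub_comm y z]
  exact h1.trans (abs_abs_sub_abs_le _ _)

theorem sum_tent_add_intCast (y : ℝ) :
    ∑ m ∈ ({⌊-y⌋, ⌊-y⌋ + 1} : Finset ℤ), tent (y + m) = 1 := by
  rw [Finset.sum_pair (by simp)]
  have h1 := Int.floor_le (-y)
  have h2 := Int.lt_floor_add_one (-y)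
  have e1 : tent (y + ⌊-y⌋) = 1 + (y + ⌊-y⌋) := by
    rw [tent, abs_of_nonpos (by linarith), max_eq_right (by linarith)]; ring
  have e2 : tent (y + (⌊-y⌋ + 1 : ℤ)) = - (y + ⌊-y⌋) := by
    push_cast
    rw [tent, abs_of_nonneg (by linarith), max_eq_right (by linarith)]; ring
  rw [e1, e2]; ring

theorem tent_add_intCast_eq_zero {y : ℝ} {m : ℤ} (hm : m ∉ ({⌊-y⌋, ⌊-y⌋ + 1} : Finset ℤ)) :
    tent (y + m) = 0 := by
  simp only [Finset.mem_insert, Finset.mem_singleton, not_or] at hm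
  apply tent_eq_zero
  have h1 := Int.floor_le (-y)
  have h2 := Int.lt_floor_add_one (-y)
  rw [le_abs]
  rcases lt_or_gt_of_ne hm.1 with h | h
  · right
    have : (m : ℝ) + 1 ≤ ⌊-y⌋ := by exact_mod_cast h
    linarith
  · left
    have h3 : ⌊-y⌋ + 1 + 1 ≤ m := by
      rcases lt_or_gt_of_ne hm.2 with h' | h' <;> omega
    have : (⌊-y⌋ : ℝ) + 1 + 1 ≤ m := by exact_mod_cast h3
    linarith

theorem hasSum_prod_tent {κ : Type*} [Fintype κ] (y : κ → ℝ) :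
    HasSum (fun m : κ → ℤ ↦ ∏ i, tent (y i + m i)) 1 := by
  classical
  have h : ∑ m ∈ Fintype.piFinset fun i ↦ ({⌊-y i⌋, ⌊-y i⌋ + 1} : Finset ℤ),
      ∏ i, tent (y i + m i) = 1 := by
    rw [← Finset.prod_univ_sum (fun i ↦ ({⌊-y i⌋, ⌊-y i⌋ + 1} : Finset ℤ))
      fun i m ↦ tent (y i + (m : ℤ))]
    exact Finset.prod_eq_one fun i _ ↦ sum_tent_add_intCast (y i)
  rw [← h]
  refine hasSum_sum_of_ne_finset_zero fun m hm ↦ ?_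
  rw [Fintype.mem_piFinset, not_forall] at hm
  obtain ⟨i, hi⟩ := hm
  exact Finset.prod_eq_zero (Finset.mem_univ i) (tent_add_intCast_eq_zero hi)

theorem abs_prod_sub_prod_le {κ : Type*} (t : Finset κ) (f g : κ → ℝ)
    (hf : ∀ i, 0 ≤ f i ∧ f i ≤ 1) (hg : ∀ i, 0 ≤ g i ∧ g i ≤ 1) :
    |∏ i ∈ t, f i - ∏ i ∈ t, g i| ≤ ∑ i ∈ t, |f i - g i| := by
  classical
  induction t using Finset.induction_on with
  | empty => simp
  | insert a t ha ih =>
    rw [Finset.prod_insert ha, Finset.prod_insert ha, Finset.sum_insert ha]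
    have h0 : 0 ≤ ∏ i ∈ t, f i := Finset.prod_nonneg fun i _ ↦ (hf i).1
    have h1 : ∏ i ∈ t, f i ≤ 1 := Finset.prod_le_one (fun i _ ↦ (hf i).1) fun i _ ↦ (hf i).2
    calc |f a * ∏ i ∈ t, f i - g a * ∏ i ∈ t, g i|
        = |(f a - g a) * ∏ i ∈ t, f i + g a * (∏ i ∈ t, f i - ∏ i ∈ t, g i)| := by congr 1; ring
      _ ≤ |f a - g a| * |∏ i ∈ t, f i| + |g a| * |∏ i ∈ t, f i - ∏ i ∈ t, g i| := by
        rw [← abs_mul, ← abs_mul]; exact abs_add_le _ _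
      _ ≤ |f a - g a| * 1 + 1 * ∑ i ∈ t, |f i - g i| := by
        gcongr
        · rwa [abs_of_nonneg h0]
        · rw [abs_of_nonneg (hg a).1]; exact (hg a).2
      _ = _ := by ring

variable {ι κ : Type*} [Fintype κ]

/-- A product of tent functions in the coordinates of `(log |x w|) w` with respect to `B`. -/
noncomputable def logTent (B : Basis κ ℝ (ι → ℝ)) (y : ι → ℝ) : ℝ := ∏ i, tent (B.repr y i)

theorem logTent_nonneg (B : Basis κ ℝ (ι → ℝ)) (y : ι → ℝ) : 0 ≤ logTent B y :=
  Finset.prod_nonneg fun _ _ ↦ tent_nonneg _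

theorem logTent_le_one (B : Basis κ ℝ (ι → ℝ)) (y : ι → ℝ) : logTent B y ≤ 1 :=
  Finset.prod_le_one (fun _ _ ↦ tent_nonneg _) fun _ _ ↦ tent_le_one _

variable [Fintype ι]

/-- The odd weight function `∏ sign (x w) * (∏ |x w|) ^ (-s) * logTent B (log |x|)`. -/
noncomputable def oddWeight (B : Basis κ ℝ (ι → ℝ)) (s : ℝ) (x : ι → ℝ) : ℝ :=
  (∏ w, (SignType.sign (x w) : ℝ)) *
    (Real.exp (-s * ∑ w, Real.log (x w)) * logTent B fun w ↦ Real.log (x w))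

theorem exists_norm_le_of_logTent_ne_zero (B : Basis κ ℝ (ι → ℝ)) :
    ∃ M : ℝ, 0 ≤ M ∧ ∀ y, logTent B y ≠ 0 → ‖y‖ ≤ M := by
  refine ⟨∑ i, ‖B i‖, by positivity, fun y hy ↦ ?_⟩
  calc ‖y‖ = ‖∑ i, B.repr y i • B i‖ := by rw [B.sum_repr]
    _ ≤ ∑ i, ‖B.repr y i • B i‖ := norm_sum_le _ _
    _ ≤ ∑ i, ‖B i‖ := by
      refine Finset.sum_le_sum fun i _ ↦ ?_
      rw [norm_smul]
      refine mul_le_of_le_one_left (norm_nonneg _) ?_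
      by_contra! h
      exact hy (Finset.prod_eq_zero (Finset.mem_univ i) (tent_eq_zero h.le))

theorem exists_abs_logTent_sub_le (B : Basis κ ℝ (ι → ℝ)) :
    ∃ A : ℝ, 0 ≤ A ∧ ∀ y z, |logTent B y - logTent B z| ≤ A * ‖y - z‖ := by
  classical
  let φ : κ → (ι → ℝ) →L[ℝ] ℝ := fun i ↦ LinearMap.toContinuousLinearMap (B.coord i)
  refine ⟨∑ i, ‖φ i‖, by positivity, fun y z ↦ ?_⟩
  refine (abs_prod_sub_prod_le _ _ _ (fun i ↦ ⟨tent_nonneg _, tent_le_one _⟩)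
    fun i ↦ ⟨tent_nonneg _, tent_le_one _⟩).trans ?_
  rw [Finset.sum_mul]
  refine Finset.sum_le_sum fun i _ ↦ (abs_tent_sub_tent_le _ _).trans ?_
  have := (φ i).le_opNorm (y - z)
  simpa [φ, Basis.coord_apply] using this


theorem sign_eq_and_abs_log_sub_le {δ a b : ℝ} (hδ : 0 < δ) (ha : δ ≤ |a|)
    (hab : |a - b| < δ / 2) :
    SignType.sign a = SignType.sign b ∧ |Real.log a - Real.log b| ≤ 2 / δ * |a - b| := by
  wlog h0 : 0 < a generalizing a b
  · have ha0 : 0 < -a := by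
      rcases lt_trichotomy a 0 with h | h | h
      · linarith
      · simp [h] at ha; linarith
      · exact absurd h h0
    have h := this (a := -a) (b := -b) (by simpa using ha)
      (by rwa [neg_sub_neg, abs_sub_comm]) ha0
    rw [Left.sign_neg, Left.sign_neg, neg_inj, Real.log_neg_eq_log, Real.log_neg_eq_log,
      neg_sub_neg, abs_sub_comm b a] at h
    exact h
  rw [abs_of_pos h0] at ha
  have hb : δ / 2 < b := by linarith [(abs_lt.mp hab).2]
  have hb0 : 0 < b := by linarith
  refine ⟨by rw [sign_pos h0, sign_pos hb0], ?_⟩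
  have key : ∀ {u v : ℝ}, δ / 2 ≤ u → δ / 2 ≤ v →
      Real.log u - Real.log v ≤ 2 / δ * |u - v| := fun {u v} hu hv ↦ by
    have hu0 : 0 < u := by linarith
    have hv0 : 0 < v := by linarith
    rw [← Real.log_div hu0.ne' hv0.ne']
    calc Real.log (u / v) ≤ u / v - 1 := Real.log_le_sub_one_of_pos (by positivity)
      _ = (u - v) / v := by field_simp
      _ ≤ |u - v| / v := by gcongr; exact le_abs_self _
      _ ≤ |u - v| / (δ / 2) := by gcongr
      _ = 2 / δ * |u - v| := by field_simp
  rw [abs_sub_le_iff]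
  exact ⟨key (by linarith) hb.le, by rw [abs_sub_comm a b]; exact key hb.le (by linarith)⟩

theorem abs_exp_sub_exp_le {u v c : ℝ} (hu : u ≤ c) (hv : v ≤ c) :
    |Real.exp u - Real.exp v| ≤ Real.exp c * |u - v| := by
  have key : ∀ {u v : ℝ}, u ≤ c → Real.exp u - Real.exp v ≤ Real.exp c * |u - v| :=
    fun {u v} hu ↦ by
      have h1 : Real.exp v = Real.exp u * Real.exp (v - u) := by rw [← Real.exp_add]; ring_nf
      have h2 := Real.add_one_le_exp (v - u)
      have h3 : Real.exp u ≤ Real.exp c := Real.exp_le_exp.mpr hu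
      have h4 := le_abs_self (u - v)
      have h5 := Real.exp_pos u
      calc Real.exp u - Real.exp v = Real.exp u * (1 - Real.exp (v - u)) := by rw [h1]; ring
        _ ≤ Real.exp u * |u - v| := by gcongr; linarith
        _ ≤ _ := by gcongr
  rw [abs_sub_le_iff]
  exact ⟨key hu, by rw [abs_sub_comm u v]; exact key hv⟩

theorem abs_prod_sign_le_one (x : ι → ℝ) : |∏ w, (SignType.sign (x w) : ℝ)| ≤ 1 := by
  rw [Finset.abs_prod]
  refine Finset.prod_le_one (fun _ _ ↦ abs_nonneg _) fun w _ ↦ ?_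
  rcases lt_trichotomy (x w) 0 with h | h | h <;> simp [h]

theorem neg_mul_sum_le {s r : ℝ} {y : ι → ℝ} (hs : s ∈ Set.Icc (1 : ℝ) 2) (hy : ‖y‖ ≤ r) :
    -s * ∑ w, y w ≤ 2 * Fintype.card ι * r := by
  have h1 : |∑ w, y w| ≤ Fintype.card ι * r := by
    refine (Finset.abs_sum_le_sum_abs _ _).trans ?_
    refine (Finset.sum_le_card_nsmul _ _ r fun w _ ↦ (norm_le_pi_norm y w).trans hy).trans ?_
    simp
  calc -s * ∑ w, y w ≤ |-s * ∑ w, y w| := le_abs_self _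
    _ = s * |∑ w, y w| := by rw [abs_mul, abs_neg, abs_of_nonneg (by linarith [hs.1])]
    _ ≤ 2 * (Fintype.card ι * r) := by gcongr; exact hs.2
    _ = _ := by ring

theorem exists_lipschitzWith_oddWeight (B : Basis κ ℝ (ι → ℝ)) :
    ∃ (A : NNReal) (R : ℝ), ∀ s ∈ Set.Icc (1 : ℝ) 2, LipschitzWith A (oddWeight B s) ∧
      ∀ x, R < ‖x‖ → oddWeight B s x = 0 := by
  obtain ⟨M, hM0, hM⟩ := exists_norm_le_of_logTent_ne_zero B
  obtain ⟨A, hA0, hA⟩ := exists_abs_logTent_sub_le B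
  set n : ℝ := ((Fintype.card ι : ℕ) : ℝ) with hn
  set δ : ℝ := Real.exp (-M) with hδ
  have hδ0 : 0 < δ := Real.exp_pos _
  set E : ℝ := Real.exp (2 * n * (M + 1)) with hE
  have hE0 : 0 < E := Real.exp_pos _
  have hn0 : 0 ≤ n := Nat.cast_nonneg _
  have hsupp : ∀ {s : ℝ} {x : ι → ℝ}, oddWeight B s x ≠ 0 →
      ‖fun w ↦ Real.log (x w)‖ ≤ M ∧ ∀ w, x w ≠ 0 := fun {s x} hx ↦ by
    refine ⟨hM _ fun h ↦ hx (by simp [oddWeight, h]), fun w hw ↦ hx ?_⟩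
    rw [oddWeight, Finset.prod_eq_zero (Finset.mem_univ w) (by simp [hw]), zero_mul]
  have hcoord : ∀ {s : ℝ} {x : ι → ℝ}, oddWeight B s x ≠ 0 → ∀ w, δ ≤ |x w| ∧ |x w| ≤ Real.exp M :=
    fun {s x} hx w ↦ by
      obtain ⟨h1, h2⟩ := hsupp hx
      have h3 := abs_le.mp ((norm_le_pi_norm _ w).trans h1)
      rw [hδ, ← Real.le_log_iff_exp_le (abs_pos.mpr (h2 w)),
        ← Real.log_le_iff_le_exp (abs_pos.mpr (h2 w)), Real.log_abs]
      exact h3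
  have hbd : ∀ {s : ℝ} {x : ι → ℝ}, s ∈ Set.Icc (1 : ℝ) 2 → |oddWeight B s x| ≤ E :=
    fun {s x} hs ↦ by
      by_cases hx : oddWeight B s x = 0
      · rw [hx, abs_zero]; exact hE0.le
      rw [oddWeight, abs_mul, abs_mul, abs_of_nonneg (logTent_nonneg _ _), Real.abs_exp]
      have h1 := neg_mul_sum_le hs (hsupp hx).1
      calc _ ≤ 1 * (E * 1) := by
            gcongr
            · exact mul_nonneg (Real.exp_pos _).le (logTent_nonneg _ _)
            · exact abs_prod_sign_le_one x
            · exact logTent_nonneg _ _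
            · rw [hE, Real.exp_le_exp]
              refine h1.trans ?_
              gcongr
              linarith
            · exact logTent_le_one _ _
        _ = E := by ring
  have hloc : ∀ {s : ℝ} {x x' : ι → ℝ}, s ∈ Set.Icc (1 : ℝ) 2 → oddWeight B s x ≠ 0 →
      ‖x - x'‖ < δ / 2 →
      |oddWeight B s x - oddWeight B s x'| ≤ E * (A + 2 * n) * (2 / δ) * ‖x - x'‖ := by
    intro s x x' hs hx hxx
    have hw : ∀ w, SignType.sign (x w) = SignType.sign (x' w) ∧
        |Real.log (x w) - Real.log (x' w)| ≤ 2 / δ * |x w - x' w| := fun w ↦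
      sign_eq_and_abs_log_sub_le hδ0 (hcoord hx w).1
        ((norm_le_pi_norm (x - x') w).trans_lt hxx)
    set y : ι → ℝ := fun w ↦ Real.log (x w) with hy
    set y' : ι → ℝ := fun w ↦ Real.log (x' w) with hy'
    have hyy : ‖y - y'‖ ≤ 2 / δ * ‖x - x'‖ := by
      rw [pi_norm_le_iff_of_nonneg (by positivity)]
      intro w
      refine (hw w).2.trans ?_
      gcongr
      exact norm_le_pi_norm (x - x') w
    have hyy1 : ‖y - y'‖ ≤ 1 := by
      refine hyy.trans ?_
      calc 2 / δ * ‖x - x'‖ ≤ 2 / δ * (δ / 2) := by gcongr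
        _ = 1 := by field_simp
    have hyM : ‖y‖ ≤ M + 1 := (hsupp hx).1.trans (by linarith)
    have hyM' : ‖y'‖ ≤ M + 1 := by
      have h1 := (hsupp hx).1
      have h2 := norm_sub_norm_le y' y
      rw [norm_sub_rev] at h2
      linarith
    have hexp := abs_exp_sub_exp_le (neg_mul_sum_le hs hyM) (neg_mul_sum_le hs hyM')
    have hsum : |-s * ∑ w, y w - -s * ∑ w, y' w| ≤ 2 * n * ‖y - y'‖ := by
      have := neg_mul_sum_le (ι := ι) (y := y - y') hs le_rfl
      have h' := neg_mul_sum_le (ι := ι) (y := y' - y) hs le_rfl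
      rw [norm_sub_rev] at h'
      simp only [Pi.sub_apply, Finset.sum_sub_distrib] at this h'
      rw [abs_le]
      constructor <;> linarith
    have hsign : ∏ w, (SignType.sign (x' w) : ℝ) = ∏ w, (SignType.sign (x w) : ℝ) :=
      Finset.prod_congr rfl fun w _ ↦ by rw [(hw w).1]
    rw [oddWeight, oddWeight, hsign, ← mul_sub, abs_mul]
    calc _ ≤ 1 * |Real.exp (-s * ∑ w, y w) * logTent B y -
            Real.exp (-s * ∑ w, y' w) * logTent B y'| := by
          gcongr; exact abs_prod_sign_le_one x
      _ = |Real.exp (-s * ∑ w, y w) * (logTent B y - logTent B y') +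
            (Real.exp (-s * ∑ w, y w) - Real.exp (-s * ∑ w, y' w)) * logTent B y'| := by
          rw [one_mul]; congr 1; ring
      _ ≤ |Real.exp (-s * ∑ w, y w)| * |logTent B y - logTent B y'| +
            |Real.exp (-s * ∑ w, y w) - Real.exp (-s * ∑ w, y' w)| * |logTent B y'| := by
          rw [← abs_mul, ← abs_mul]; exact abs_add_le _ _
      _ ≤ E * (A * ‖y - y'‖) + E * (2 * n * ‖y - y'‖) * 1 := by
          gcongr
          · rw [Real.abs_exp, hE, Real.exp_le_exp]
            exact neg_mul_sum_le hs hyM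
          · exact hA y y'
          · exact hexp.trans (by gcongr)
          · rw [abs_of_nonneg (logTent_nonneg _ _)]; exact logTent_le_one _ _
      _ = E * (A + 2 * n) * ‖y - y'‖ := by ring
      _ ≤ E * (A + 2 * n) * (2 / δ * ‖x - x'‖) := by gcongr
      _ = _ := by ring
  have hC1 : 0 ≤ E * (A + 2 * n) * (2 / δ) := by positivity
  have hC2 : 0 ≤ 4 * E / δ := by positivity
  refine ⟨Real.toNNReal (E * (A + 2 * n) * (2 / δ) + 4 * E / δ), Real.exp M,
    fun s hs ↦ ⟨LipschitzWith.of_dist_le_mul fun x x' ↦ ?_, fun x hx ↦ ?_⟩⟩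
  · rw [Real.dist_eq, dist_eq_norm, Real.coe_toNNReal _ (add_nonneg hC1 hC2), add_mul]
    have h1 := mul_nonneg hC1 (norm_nonneg (x - x'))
    have h2 := mul_nonneg hC2 (norm_nonneg (x - x'))
    rcases lt_or_ge ‖x - x'‖ (δ / 2) with h | h
    · by_cases hx : oddWeight B s x = 0
      · by_cases hx' : oddWeight B s x' = 0
        · rw [hx, hx', sub_zero, abs_zero]; linarith
        · rw [norm_sub_rev] at h h1 h2 ⊢
          rw [abs_sub_comm]
          linarith [hloc hs hx' h]
      · linarith [hloc hs hx h]
    · have h3 : 2 * E ≤ 4 * E / δ * ‖x - x'‖ := by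
        calc 2 * E = 4 * E / δ * (δ / 2) := by field_simp; ring
          _ ≤ _ := by gcongr
      have h4 := abs_sub (oddWeight B s x) (oddWeight B s x')
      linarith [hbd (x := x) hs, hbd (x := x') hs]
  · by_contra h
    exact hx.not_ge ((pi_norm_le_iff_of_nonneg (Real.exp_pos _).le).mpr fun w ↦ (hcoord h w).2)

theorem integral_oddWeight [Nonempty ι] (B : Basis κ ℝ (ι → ℝ)) (s : ℝ)
    (hm : Continuous (oddWeight B s)) : ∫ x, oddWeight B s x = 0 := by
  classical
  obtain ⟨i⟩ := ‹Nonempty ι›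
  let f : ι → ℝ → ℝ := fun w ↦ if w = i then fun a ↦ -a else id
  have hf : MeasurePreserving (fun (x : ι → ℝ) w ↦ f w (x w)) volume volume := by
    refine volume_preserving_pi fun w ↦ ?_
    by_cases h : w = i
    · simpa only [f, h, if_true] using Measure.measurePreserving_neg (volume : Measure ℝ)
    · simpa only [f, h, if_false] using MeasurePreserving.id volume
  have hodd : ∀ x, oddWeight B s (fun w ↦ f w (x w)) = -oddWeight B s x := fun x ↦ by
    have hlog : ∀ w, Real.log (f w (x w)) = Real.log (x w) := fun w ↦ by
      by_cases h : w = i <;> simp [f, h]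
    have hsign : ∏ w, (SignType.sign (f w (x w)) : ℝ) = -∏ w, (SignType.sign (x w) : ℝ) := by
      rw [← Finset.mul_prod_erase _ _ (Finset.mem_univ i),
        ← Finset.mul_prod_erase Finset.univ (fun w ↦ (SignType.sign (x w) : ℝ))
          (Finset.mem_univ i), ← neg_mul]
      congr 1
      · simp [f, Left.sign_neg]
      · exact Finset.prod_congr rfl fun w hw ↦ by simp [f, Finset.ne_of_mem_erase hw]
    simp only [oddWeight, hlog, hsign, neg_mul]
  have h1 : ∫ x, oddWeight B s x = ∫ x : ι → ℝ, oddWeight B s (fun w ↦ f w (x w)) := by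
    conv_lhs => rw [← hf.map_eq]
    exact integral_map hf.aemeasurable hm.aestronglyMeasurable
  simp only [hodd, integral_neg] at h1
  linarith

end Weight

section WeightedLatticeSum
open MeasureTheory Module

theorem finite_setOf_norm_sum_intCast_smul_le {E κ : Type*} [NormedAddCommGroup E]
    [NormedSpace ℝ E] [FiniteDimensional ℝ E] [Fintype κ] (b : Basis κ ℝ E) (R : ℝ) :
    {m : κ → ℤ | ‖∑ i, (m i : ℝ) • b i‖ ≤ R}.Finite := by
  classical
  let φ : κ → E →L[ℝ] ℝ := fun i ↦ LinearMap.toContinuousLinearMap (b.coord i)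
  refine (Fintype.piFinset fun i ↦ Finset.Icc (-⌈‖φ i‖ * R⌉) ⌈‖φ i‖ * R⌉).finite_toSet.subset
    fun m hm ↦ ?_
  rw [Finset.mem_coe, Fintype.mem_piFinset]
  intro i
  have h1 := (φ i).le_opNorm (∑ i, (m i : ℝ) • b i)
  have h2 : φ i (∑ i, (m i : ℝ) • b i) = m i := by
    change b.repr (∑ i, (m i : ℝ) • b i) i = m i
    rw [b.repr_sum_self]
  rw [h2, Real.norm_eq_abs] at h1
  have h3 : |(m i : ℝ)| ≤ ⌈‖φ i‖ * R⌉ :=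
    (h1.trans (mul_le_mul_of_nonneg_left hm (norm_nonneg _))).trans (Int.le_ceil _)
  rw [Finset.mem_Icc, ← abs_le]
  exact_mod_cast h3

/-- Division with remainder by `3` in every coordinate. -/
def piIntDivModEquiv (κ : Type*) : (κ → ℤ) ≃ (κ → Fin 3) × (κ → ℤ) :=
  ((Equiv.piCongrRight fun _ ↦ (Int.divModEquiv 3).trans (Equiv.prodComm _ _))).trans
    (Equiv.arrowProdEquivProdArrow κ (fun _ ↦ Fin 3) fun _ ↦ ℤ)

theorem piIntDivModEquiv_symm_apply {κ : Type*} (r : κ → Fin 3) (q : κ → ℤ) (i : κ) :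
    (piIntDivModEquiv κ).symm (r, q) i = q i * 3 + (r i : ℕ) := by
  simp [piIntDivModEquiv, Int.divModEquiv]

theorem exists_bound_abs_tsum_periodic {E κ : Type*} [NormedAddCommGroup E] [NormedSpace ℝ E]
    [FiniteDimensional ℝ E] [MeasurableSpace E] [BorelSpace E] (μ : Measure E)
    [μ.IsAddHaarMeasure] [Fintype κ] (b : Basis κ ℝ E) (f : (κ → ℤ) → ℝ)
    (hf : ∀ m q : κ → ℤ, f (fun i ↦ q i * 3 + m i) = f m) (A : NNReal) (R : ℝ) :
    ∃ C : ℝ, 0 ≤ C ∧ ∀ H : E → ℝ, LipschitzWith A H → (∀ x, R < ‖x‖ → H x = 0) →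
      ∫ x, H x ∂μ = 0 → ∀ t : ℝ, 0 < t →
      |∑' m : κ → ℤ, f m * H (t⁻¹ • ∑ i, (m i : ℝ) • b i)| ≤
        C * (1 + t) ^ Fintype.card κ / t := by
  classical
  let b' : Basis κ ℝ E := b.isUnitSMul (w := fun _ ↦ (3 : ℝ)) fun _ ↦ (by norm_num)
  have hb' : ∀ i, b' i = (3 : ℝ) • b i := fun i ↦ Basis.isUnitSMul_apply _ i
  choose C hC using fun r : κ → Fin 3 ↦
    exists_bound_abs_tsum_lattice μ b' (∑ i, (((r i : ℕ) : ℤ) : ℝ) • b i) R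
  refine ⟨∑ r : κ → Fin 3, |f fun i ↦ ((r i : ℕ) : ℤ)| * (|C r| * A), by positivity,
    fun H hA hR hH t ht ↦ ?_⟩
  have hsum : Summable fun m : κ → ℤ ↦ f m * H (t⁻¹ • ∑ i, (m i : ℝ) • b i) := by
    refine summable_of_hasFiniteSupport
      ((finite_setOf_norm_sum_intCast_smul_le b (t * R)).subset fun m hm ↦ ?_)
    by_contra h
    refine hm ?_
    rw [Set.mem_ofPred_eq, not_le] at h
    have : R < ‖t⁻¹ • ∑ i, (m i : ℝ) • b i‖ := by
      rwa [norm_smul, norm_inv, Real.norm_of_nonneg ht.le, lt_inv_mul_iff₀ ht]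
    simp [hR _ this]
  have hprod := ((piIntDivModEquiv κ).symm.summable_iff.mpr hsum).tsum_prod
  simp only [Function.comp_apply] at hprod
  rw [← (piIntDivModEquiv κ).symm.tsum_eq, hprod, tsum_fintype]
  refine (Finset.abs_sum_le_sum_abs _ _).trans ?_
  rw [Finset.sum_mul, Finset.sum_div]
  refine Finset.sum_le_sum fun r _ ↦ ?_
  have hterm : ∀ q : κ → ℤ, f ((piIntDivModEquiv κ).symm (r, q)) *
      H (t⁻¹ • ∑ i, ((piIntDivModEquiv κ).symm (r, q) i : ℝ) • b i) =
      f (fun i ↦ ((r i : ℕ) : ℤ)) *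
        H (t⁻¹ • (∑ i, (((r i : ℕ) : ℤ) : ℝ) • b i + ∑ i, (q i : ℝ) • b' i)) := fun q ↦ by
    congr 1
    · rw [← hf (fun i ↦ ((r i : ℕ) : ℤ)) q]
      congr 1
    · rw [← Finset.sum_add_distrib]
      congr 2
      refine Finset.sum_congr rfl fun i _ ↦ ?_
      rw [piIntDivModEquiv_symm_apply, hb', smul_smul, ← add_smul, add_comm]
      push_cast
      rfl
  simp only [hterm]
  rw [tsum_mul_left, abs_mul, mul_assoc, mul_div_assoc]
  gcongr
  refine (hC r A H hA hR hH t ht).trans ?_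
  gcongr
  exact le_abs_self _

variable {ι κ κ' : Type*} [Fintype ι] [Nonempty ι] [Fintype κ] [Fintype κ']

theorem exists_bound_abs_tsum_oddWeight (B : Basis κ ℝ (ι → ℝ)) (b : Basis κ' ℝ (ι → ℝ))
    (f : (κ' → ℤ) → ℝ) (hf : ∀ m q : κ' → ℤ, f (fun i ↦ q i * 3 + m i) = f m)
    (hf' : ∀ m, f m ≠ 0 → 1 ≤ ∏ w, |(∑ i, (m i : ℝ) • b i) w|) :
    ∃ D : ℝ, ∀ s ∈ Set.Icc (1 : ℝ) 2, ∀ k : ℤ,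
      |Real.exp (-s * (Fintype.card ι * k)) *
        ∑' m : κ' → ℤ, f m * oddWeight B s ((Real.exp k)⁻¹ • ∑ i, (m i : ℝ) • b i)| ≤
      D * Real.exp (-|(k : ℝ)|) := by
  obtain ⟨A, R, hAR⟩ := exists_lipschitzWith_oddWeight B
  obtain ⟨C, hC0, hC⟩ := exists_bound_abs_tsum_periodic volume b f hf A R
  have hcard : Fintype.card κ' = Fintype.card ι := by
    rw [← Module.finrank_eq_card_basis b, Module.finrank_fintype_fun_eq_card]
  set n := Fintype.card ι with hn
  have hn0 : 0 < n := Fintype.card_pos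
  set r := Real.log (max R 1) with hr
  have hr0 : 0 ≤ r := Real.log_nonneg (le_max_right _ _)
  refine ⟨C * 2 ^ n * Real.exp (2 * n * r + 2 * r), fun s hs k ↦ ?_⟩
  by_cases hk : (k : ℝ) < -r
  · have hzero : ∀ m : κ' → ℤ,
        f m * oddWeight B s ((Real.exp k)⁻¹ • ∑ i, (m i : ℝ) • b i) = 0 := fun m ↦ by
      by_contra h
      have h1 := hf' m (left_ne_zero_of_mul h)
      have h2 : ‖(Real.exp k)⁻¹ • ∑ i, (m i : ℝ) • b i‖ ≤ max R 1 := by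
        by_contra! h'
        exact right_ne_zero_of_mul h ((hAR s hs).2 _ ((le_max_left _ _).trans_lt h'))
      set x := ∑ i, (m i : ℝ) • b i
      have h3 : ∀ w, |x w| ≤ Real.exp k * max R 1 := fun w ↦ by
        have := (norm_le_pi_norm _ w).trans h2
        rwa [Pi.smul_apply, smul_eq_mul, Real.norm_eq_abs, abs_mul, abs_inv, Real.abs_exp,
          inv_mul_le_iff₀ (Real.exp_pos _)] at this
      have h4 : ∏ w, |x w| ≤ (Real.exp k * max R 1) ^ n := by
        refine (Finset.prod_le_prod (fun _ _ ↦ abs_nonneg _) fun w _ ↦ h3 w).trans ?_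
        simp [hn]
      have h5 : Real.exp k * max R 1 < 1 := by
        have : max R 1 = Real.exp r := (Real.exp_log (by positivity)).symm
        rw [this, ← Real.exp_add, Real.exp_lt_one_iff]
        linarith
      have h6 : (Real.exp k * max R 1) ^ n < 1 :=
        pow_lt_one₀ (by positivity) h5 hn0.ne'
      linarith
    simp only [hzero, tsum_zero, mul_zero, abs_zero]
    positivity
  · rw [not_lt] at hk
    have h1 := hC _ (hAR s hs).1 (hAR s hs).2
      (integral_oddWeight B s (hAR s hs).1.continuous) (Real.exp k) (Real.exp_pos _)
    rw [hcard] at h1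
    rw [abs_mul, Real.abs_exp]
    have hexp : (1 + Real.exp k) ^ n ≤ 2 ^ n * Real.exp (n * max (k : ℝ) 0) := by
      rw [Real.exp_nat_mul, ← mul_pow]
      gcongr
      have e1 : 1 ≤ Real.exp (max (k : ℝ) 0) := Real.one_le_exp (le_max_right _ _)
      have e2 : Real.exp k ≤ Real.exp (max (k : ℝ) 0) := Real.exp_le_exp.mpr (le_max_left _ _)
      linarith
    calc _ ≤ Real.exp (-s * (n * k)) *
          (C * (2 ^ n * Real.exp (n * max (k : ℝ) 0)) / Real.exp k) := by
          gcongr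
          exact h1.trans (by gcongr)
      _ = C * 2 ^ n * Real.exp (-s * (n * k) + n * max (k : ℝ) 0 - k) := by
          rw [Real.exp_sub, Real.exp_add]; ring
      _ ≤ C * 2 ^ n * Real.exp (2 * n * r + 2 * r - |(k : ℝ)|) := by
          have hn0' : (0 : ℝ) ≤ n := Nat.cast_nonneg n
          refine mul_le_mul_of_nonneg_left (Real.exp_le_exp.mpr ?_) (by positivity)
          have hnr : 0 ≤ n * r := by positivity
          rcases le_total 0 (k : ℝ) with h | h
          · rw [max_eq_left h, abs_of_nonneg h]
            have : 0 ≤ (s - 1) * (n * k) := mul_nonneg (by linarith [hs.1]) (by positivity)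
            linarith
          · rw [max_eq_right h, abs_of_nonpos h]
            have h2 : n * -(k : ℝ) ≤ n * r := by gcongr; linarith
            have h3 : s * (n * -(k : ℝ)) ≤ 2 * (n * r) :=
              mul_le_mul hs.2 h2 (mul_nonneg hn0' (by linarith)) (by norm_num)
            linarith
      _ = _ := by rw [sub_eq_add_neg, Real.exp_add]; ring

end WeightedLatticeSum

section UnitSum
open NumberField.InfinitePlace NumberField.Units.dirichletUnitTheorem
  NumberField.mixedEmbedding Module
open NumberField.mixedEmbedding.fundamentalCone hiding equivFinRank
open NumberField.Units hiding equivFinRank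

theorem hasSum_prod_tent_of_finite (T : Type*) [Finite T] {κ : Type*} [Fintype κ] (y : κ → ℝ) :
    HasSum (fun p : T × (κ → ℤ) ↦ ∏ i, tent (y i + p.2 i)) (Nat.card T) := by
  have : Fintype T := Fintype.ofFinite T
  have h1 : HasSum (fun _ : T ↦ (1 : ℝ)) (Nat.card T) := by
    simpa [Nat.card_eq_fintype_card] using hasSum_fintype fun _ : T ↦ (1 : ℝ)
  have h2 := hasSum_prod_tent y
  have h3 := h1.mul h2 (h1.summable.mul_of_nonneg h2.summable
    (Pi.le_def.mpr fun _ ↦ zero_le_one)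
    (Pi.le_def.mpr fun _ ↦ Finset.prod_nonneg fun _ _ ↦ tent_nonneg _))
  simpa only [one_mul, mul_one] using h3

variable (K : Type*) [Field K] [NumberField K]

theorem completeBasis_apply_w₀ [IsTotallyReal K] (w : InfinitePlace K) :
    completeBasis K w₀ w = 1 := by
  simp [completeBasis_apply_of_eq, IsTotallyReal.mult_eq]

theorem completeBasis_apply_equivFinRank [IsTotallyReal K] (i : Fin (rank K))
    (w : InfinitePlace K) : completeBasis K (fundamentalCone.equivFinRank (K := K) i) w =
      Real.log (w (fundSystem K i : K)) := by
  rw [completeBasis_apply_of_ne, expMap_symm_apply, normAtAllPlaces_mixedEmbedding,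
    Equiv.symm_apply_apply, IsTotallyReal.mult_eq, Nat.cast_one, one_mul]

/-- The unit, together with an integer, attached to integral coordinates with respect to
`completeBasis K`. -/
noncomputable def unitOfCoord (p : torsion K × (InfinitePlace K → ℤ)) : (𝓞 K)ˣ × ℤ :=
  (p.1 * ∏ i, fundSystem K i ^ p.2 (fundamentalCone.equivFinRank (K := K) i), -p.2 w₀)

theorem bijective_unitOfCoord : Function.Bijective (unitOfCoord K) := by
  classical
  constructor
  · rintro ⟨ζ, m⟩ ⟨ζ', m'⟩ h
    rw [unitOfCoord, unitOfCoord, Prod.mk.injEq, neg_inj] at h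
    obtain ⟨_, _, huniq⟩ := exist_unique_eq_mul_prod K
      (ζ * ∏ i, fundSystem K i ^ m (fundamentalCone.equivFinRank (K := K) i))
    have h1 := huniq (ζ, fun i ↦ m (fundamentalCone.equivFinRank (K := K) i)) rfl
    have h2 := huniq (ζ', fun i ↦ m' (fundamentalCone.equivFinRank (K := K) i)) h.1
    have h3 := h1.trans h2.symm
    rw [Prod.mk.injEq] at h3
    refine Prod.ext h3.1 (funext fun w ↦ ?_)
    by_cases hw : w = w₀
    · rw [hw]; exact h.2
    · simpa using congrFun h3.2 (fundamentalCone.equivFinRank.symm ⟨w, hw⟩)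
  · rintro ⟨u, k⟩
    obtain ⟨⟨ζ, e⟩, hu, _⟩ := exist_unique_eq_mul_prod K u
    refine ⟨(ζ, fun w ↦ if h : w = w₀ then -k else
      e (fundamentalCone.equivFinRank.symm ⟨w, h⟩)), ?_⟩
    rw [unitOfCoord, Prod.mk.injEq]
    refine ⟨?_, by simp⟩
    rw [hu]
    congr 1
    refine Finset.prod_congr rfl fun i _ ↦ ?_
    simp [(fundamentalCone.equivFinRank (K := K) i).2]

variable [IsTotallyReal K]

theorem log_unitOfCoord (p : torsion K × (InfinitePlace K → ℤ)) (w : InfinitePlace K) :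
    Real.log (w ((unitOfCoord K p).1 : K)) - (unitOfCoord K p).2 =
      ∑ j, p.2 j * completeBasis K j w := by
  classical
  have h1 : ∑ j, p.2 j * completeBasis K j w = p.2 w₀ * completeBasis K w₀ w +
      ∑ j : {w : InfinitePlace K // w ≠ w₀}, p.2 j * completeBasis K j w := by
    rw [← Finset.add_sum_erase _ _ (Finset.mem_univ w₀)]
    congr 1
    exact Finset.sum_subtype _ (by simp) _
  rw [h1, completeBasis_apply_w₀, ← fundamentalCone.equivFinRank.sum_comp]
  simp only [completeBasis_apply_equivFinRank, unitOfCoord]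
  have h2 : w ((p.1 : (𝓞 K)ˣ) : K) = 1 := by
    exact (mem_torsion K).mp p.1.2 w
  push_cast
  rw [map_mul, h2, one_mul, map_prod, Real.log_prod]
  · simp [add_comm, coe_zpow, map_zpow₀, Real.log_zpow]
  · intro i _
    simp

theorem logTent_unitOfCoord (y : InfinitePlace K → ℝ) (p : torsion K × (InfinitePlace K → ℤ)) :
    logTent (completeBasis K) (fun w ↦ y w + (Real.log (w ((unitOfCoord K p).1 : K)) -
      (unitOfCoord K p).2)) = ∏ i, tent ((completeBasis K).repr y i + p.2 i) := by
  have h : (fun w ↦ y w + (Real.log (w ((unitOfCoord K p).1 : K)) - (unitOfCoord K p).2)) =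
      y + ∑ j, (p.2 j : ℝ) • completeBasis K j := by
    ext w
    rw [log_unitOfCoord]
    simp [Finset.sum_apply]
  rw [h, logTent]
  refine Finset.prod_congr rfl fun i _ ↦ ?_
  rw [map_add, Finsupp.add_apply, (completeBasis K).repr_sum_self]

theorem hasSum_logTent_units (y : InfinitePlace K → ℝ) :
    HasSum (fun p : (𝓞 K)ˣ × ℤ ↦ logTent (completeBasis K)
      fun w ↦ y w + (Real.log (w (p.1 : K)) - p.2)) (torsionOrder K) := by
  have h := hasSum_prod_tent_of_finite (torsion K) ((completeBasis K).repr y)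
  simp only [← logTent_unitOfCoord] at h
  exact (Equiv.ofBijective _ (bijective_unitOfCoord K)).hasSum_iff.mp h

end UnitSum

section NormForm
open Module NumberField.InfinitePlace

variable {K : Type*} [Field K]

/-- The multiplication map `x ↦ x • a` from a ring to one of its ideals. -/
def Ideal.smulRightInt {R : Type*} [CommRing R] (J : Ideal R) (a : J) : R →ₗ[ℤ] J :=
  (LinearMap.toSpanSingleton R J a).restrictScalars ℤ

theorem exists_norm_eq_mul_det [NumberField K] {κ : Type*} [Fintype κ] [DecidableEq κ]
    {J : Ideal (𝓞 K)}
    (bO : Basis κ ℤ (𝓞 K)) (bJ : Basis κ ℤ J) :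
    ∃ (d : ℤ) (D : (κ → ℤ) → ℤ), d.natAbs = Ideal.absNorm J ∧
      (∀ m, Algebra.norm ℤ (bJ.equivFun.symm m : 𝓞 K) = d * D m) ∧
      ∀ m q : κ → ℤ, (D (fun i ↦ q i * 3 + m i) : ZMod 3) = D m := by
  refine ⟨bO.det ((↑) ∘ bJ),
    fun m ↦ (LinearMap.toMatrix bO bJ (J.smulRightInt (bJ.equivFun.symm m))).det,
    Ideal.natAbs_det_basis_change bO J bJ, fun m ↦ ?_, fun m q ↦ ?_⟩
  · have h1 : bO.toMatrix ((↑) ∘ bJ) =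
        LinearMap.toMatrix bJ bO ((Submodule.subtype J).restrictScalars ℤ) := by
      ext i j
      simp [Basis.toMatrix_apply, LinearMap.toMatrix_apply]
    rw [Basis.det_apply, h1, ← Matrix.det_mul, ← LinearMap.toMatrix_comp,
      Algebra.norm_eq_matrix_det bO, Algebra.leftMulMatrix_apply]
    congr 2
    ext x
    simp [Ideal.smulRightInt, mul_comm, mul_left_comm, Finset.mul_sum]
  · have h1 : bJ.equivFun.symm (fun i ↦ q i * 3 + m i) =
        (3 : ℤ) • bJ.equivFun.symm q + bJ.equivFun.symm m := by
      rw [← map_smul, ← map_add]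
      congr 1
      ext i
      simp [mul_comm]
    have h2 : J.smulRightInt ((3 : ℤ) • bJ.equivFun.symm q + bJ.equivFun.symm m) =
        (3 : ℤ) • J.smulRightInt (bJ.equivFun.symm q) +
          J.smulRightInt (bJ.equivFun.symm m) := by
      ext x
      simp [Ideal.smulRightInt, mul_left_comm]
    beta_reduce
    rw [h1, h2, map_add, map_smul, ← eq_intCast (Int.castRingHom (ZMod 3)),
      ← eq_intCast (Int.castRingHom (ZMod 3)), RingHom.map_det, RingHom.map_det]
    congr 1
    ext i j
    have : ((3 : ℤ) : ZMod 3) = 0 := by decide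
    simp only [RingHom.mapMatrix_apply, Matrix.map_apply, Matrix.add_apply, Matrix.smul_apply,
      smul_eq_mul, map_add, map_mul, eq_intCast, this, zero_mul, zero_add]

variable (K) [IsTotallyReal K]

/-- The embedding of a totally real number field in the product of its completions. -/
noncomputable def realEmbedding : K →+* (InfinitePlace K → ℝ) :=
  RingHom.pi fun w ↦ embedding_of_isReal (IsTotallyReal.isReal w)

variable {K}

theorem abs_realEmbedding (x : K) (w : InfinitePlace K) : |realEmbedding K x w| = w x :=
  norm_embedding_of_isReal (IsTotallyReal.isReal w) x

theorem prod_realEmbedding [NumberField K] (x : K) :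
    ∏ w, realEmbedding K x w = (Algebra.norm ℚ x : ℝ) := by
  have h : ((Algebra.norm ℚ x : ℝ) : ℂ) = ∏ w, (realEmbedding K x w : ℂ) := by
    have := Algebra.norm_eq_prod_embeddings ℚ ℂ x
    rw [eq_ratCast] at this
    rw [Complex.ofReal_ratCast, this,
      ← Fintype.prod_equiv (RingHom.equivRatAlgHom K ℂ) (fun f => f x) (fun φ => φ x) fun _ ↦ rfl]
    refine (Fintype.prod_bijective (fun w : InfinitePlace K ↦ w.embedding) ?_ _ _ fun w ↦ ?_).symm
    · refine ⟨fun w w' h ↦ ?_, fun φ ↦ ⟨InfinitePlace.mk φ, ?_⟩⟩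
      · rw [← mk_embedding w, ← mk_embedding w']
        exact congrArg InfinitePlace.mk h
      · exact embedding_mk_eq_of_isReal (IsTotallyReal.complexEmbedding_isReal φ)
    · exact embedding_of_isReal_apply (IsTotallyReal.isReal w) x
  rw [← Complex.ofReal_prod] at h
  exact_mod_cast h.symm

theorem prod_realEmbedding_int [NumberField K] (x : 𝓞 K) :
    ∏ w, realEmbedding K x w = (Algebra.norm ℤ x : ℝ) := by
  rw [prod_realEmbedding, ← Algebra.coe_norm_int, Rat.cast_intCast]

variable (K) in
/-- For a totally real number field, the mixed space is the product of the completions. -/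
noncomputable def mixedSpaceEquiv :
    mixedEmbedding.mixedSpace K ≃ₗ[ℝ] (InfinitePlace K → ℝ) where
  toFun x w := x.1 ⟨w, IsTotallyReal.isReal w⟩
  invFun y := (fun w ↦ y w, fun w ↦ absurd w.2 (not_isComplex_iff_isReal.mpr
    (IsTotallyReal.isReal w.1)))
  map_add' _ _ := rfl
  map_smul' _ _ := rfl
  left_inv _ := Prod.ext rfl (funext fun w ↦ absurd w.2 (not_isComplex_iff_isReal.mpr
    (IsTotallyReal.isReal w.1)))
  right_inv _ := rfl

theorem mixedSpaceEquiv_mixedEmbedding (x : K) :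
    mixedSpaceEquiv K (mixedEmbedding K x) = realEmbedding K x := rfl

theorem exists_basis_realEmbedding [NumberField K] {J : Ideal (𝓞 K)} (hJ : J ≠ ⊥)
    (bJ : Basis (Free.ChooseBasisIndex ℤ (𝓞 K)) ℤ J) :
    ∃ b : Basis (Free.ChooseBasisIndex ℤ (𝓞 K)) ℝ (InfinitePlace K → ℝ),
      ∀ i, b i = realEmbedding K (bJ i : 𝓞 K) := by
  classical
  let e := (mixedEmbedding.latticeBasis K).map (mixedSpaceEquiv K)
  let v := fun i ↦ realEmbedding K (bJ i : 𝓞 K)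
  have h1 : e.toMatrix v = ((RingOfIntegers.basis K).toMatrix ((↑) ∘ bJ)).map (Int.cast) := by
    ext i j
    rw [Basis.toMatrix_apply, Basis.map_repr, LinearEquiv.trans_apply]
    simp only [v]
    rw [← mixedSpaceEquiv_mixedEmbedding, LinearEquiv.symm_apply_apply,
      mixedEmbedding.latticeBasis_repr_apply, integralBasis_repr_apply]
    simp [Basis.toMatrix_apply]
  have h2 : e.det v = (((RingOfIntegers.basis K).det ((↑) ∘ bJ) : ℤ) : ℝ) := by
    rw [Basis.det_apply, h1, Basis.det_apply, ← eq_intCast (Int.castRingHom ℝ), RingHom.map_det]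
    rfl
  have h3 : IsUnit (e.det v) := by
    rw [h2, isUnit_iff_ne_zero, Int.cast_ne_zero, ← Int.natAbs_ne_zero,
      Ideal.natAbs_det_basis_change, ne_eq, Ideal.absNorm_eq_zero_iff]
    exact hJ
  obtain ⟨h4, h5⟩ := (Module.Basis.is_basis_iff_det e).mpr h3
  exact ⟨Basis.mk h4 h5.ge, fun i ↦ Basis.mk_apply h4 h5.ge i⟩

end NormForm

section DirichletSum
open Filter Topology

variable {α : Type*} {N : α → ℕ} {l : ℝ}

theorem card_le_eq_sum_card_eq (hN : ∀ a, N a ≠ 0) (hfin : ∀ n, {a | N a = n}.Finite) (n : ℕ) :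
    Nat.card {a // N a ≤ n} = ∑ k ∈ Finset.Icc 1 n, Nat.card {a // N a = k} := by
  have := Finset.card_preimage_eq_sum_card_image_eq (f := N) (s := Finset.Icc 1 n)
    fun k _ ↦ hfin k
  rw [← this]
  refine Nat.card_congr (Equiv.subtypeEquivRight fun a ↦ ?_)
  simp [Nat.one_le_iff_ne_zero, hN a]

theorem hasSum_fiber_rpow (hN : ∀ a, N a ≠ 0) (hfin : ∀ n, {a | N a = n}.Finite) (s : ℝ) (n : ℕ) :
    HasSum (fun a : {a // N a = n} ↦ (N a : ℝ) ^ (-s))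
      (LSeries.term (fun n ↦ ((Nat.card {a // N a = n} : ℝ) : ℂ)) s n).re := by
  have : Finite {a // N a = n} := hfin n
  have := Fintype.ofFinite {a // N a = n}
  convert! hasSum_fintype _
  rw [Finset.sum_congr rfl (g := fun _ ↦ (n : ℝ) ^ (-s)) fun a _ ↦ by rw [a.2]]
  rcases eq_or_ne n 0 with rfl | hn
  · simp [hN, Subtype.isEmpty_false]
  · rw [LSeries.term_of_ne_zero hn, ← Complex.ofReal_natCast n,
      ← Complex.ofReal_cpow n.cast_nonneg, ← Complex.ofReal_div, Complex.ofReal_re,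
      Finset.sum_const, nsmul_eq_mul, Finset.card_univ, ← Nat.card_eq_fintype_card,
      Real.rpow_neg n.cast_nonneg, div_eq_mul_inv]

theorem tendsto_sum_card_div (hN : ∀ a, N a ≠ 0) (hfin : ∀ n, {a | N a = n}.Finite)
    (h : Tendsto (fun x : ℝ ↦ (Nat.card {a // (N a : ℝ) ≤ x} : ℝ) / x) atTop (𝓝 l)) :
    Tendsto (fun n : ℕ ↦ (∑ k ∈ Finset.Icc 1 n, (Nat.card {a // N a = k} : ℝ)) / (n : ℝ))
      atTop (𝓝 l) := by
  refine (h.comp tendsto_natCast_atTop_atTop).congr fun n ↦ ?_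
  simp only [Function.comp_apply, Nat.cast_le, ← Nat.cast_sum, card_le_eq_sum_card_eq hN hfin]

theorem LSeriesSummable_card (hN : ∀ a, N a ≠ 0) (hfin : ∀ n, {a | N a = n}.Finite)
    (h : Tendsto (fun x : ℝ ↦ (Nat.card {a // (N a : ℝ) ≤ x} : ℝ) / x) atTop (𝓝 l))
    {s : ℝ} (hs : 1 < s) :
    LSeriesSummable (fun n ↦ ((Nat.card {a // N a = n} : ℝ) : ℂ)) s := by
  refine LSeriesSummable_of_sum_norm_bigO_and_nonneg (r := 1) ?_ (fun _ ↦ Nat.cast_nonneg _)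
    zero_le_one hs
  exact Asymptotics.isBigO_atTop_natCast_rpow_of_tendsto_div_rpow
    (by simpa using tendsto_sum_card_div hN hfin h)

theorem summable_rpow_of_tendsto_card (hN : ∀ a, N a ≠ 0) (hfin : ∀ n, {a | N a = n}.Finite)
    (h : Tendsto (fun x : ℝ ↦ (Nat.card {a // (N a : ℝ) ≤ x} : ℝ) / x) atTop (𝓝 l))
    {s : ℝ} (hs : 1 < s) : Summable fun a ↦ (N a : ℝ) ^ (-s) := by
  rw [← (Equiv.sigmaFiberEquiv N).summable_iff, summable_sigma_of_nonneg fun _ ↦ by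
    simp only [Function.comp_apply]; positivity]
  refine ⟨fun n ↦ (hasSum_fiber_rpow hN hfin s n).summable, ?_⟩
  refine (Complex.hasSum_re (LSeriesSummable_card hN hfin h hs).hasSum).summable.congr fun n ↦ ?_
  exact (hasSum_fiber_rpow hN hfin s n).tsum_eq.symm

theorem tendsto_sub_one_mul_tsum_rpow (hN : ∀ a, N a ≠ 0) (hfin : ∀ n, {a | N a = n}.Finite)
    (h : Tendsto (fun x : ℝ ↦ (Nat.card {a // (N a : ℝ) ≤ x} : ℝ) / x) atTop (𝓝 l)) :
    Tendsto (fun s : ℝ ↦ (s - 1) * ∑' a, (N a : ℝ) ^ (-s)) (𝓝[>] 1) (𝓝 l) := by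
  have h1 := LSeries_tendsto_sub_mul_nhds_one_of_tendsto_sum_div_and_nonneg _
    (tendsto_sum_card_div hN hfin h) fun _ ↦ Nat.cast_nonneg _
  refine ((Complex.continuous_re.tendsto _).comp h1).congr' ?_
  filter_upwards [self_mem_nhdsWithin] with s hs
  rw [Function.comp_apply, ← Complex.ofReal_one, ← Complex.ofReal_sub, Complex.re_ofReal_mul]
  congr 1
  rw [LSeries, Complex.re_tsum (LSeriesSummable_card hN hfin h hs),
    ← (Equiv.sigmaFiberEquiv N).tsum_eq, Summable.tsum_sigma]
  · exact tsum_congr fun n ↦ (hasSum_fiber_rpow hN hfin s n).tsum_eq.symm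
  · exact (Equiv.sigmaFiberEquiv N).summable_iff.mpr (summable_rpow_of_tendsto_card hN hfin h hs)

end DirichletSum

section IdealSum
open Filter Topology nonZeroDivisors

variable (K : Type*) [Field K] [NumberField K]

theorem Ideal.finite_absNorm_nonZeroDivisors_eq (n : ℕ) :
    {I : (Ideal (𝓞 K))⁰ | Ideal.absNorm (I : Ideal (𝓞 K)) = n}.Finite :=
  (Ideal.finite_setOfPred_absNorm_eq n).preimage Subtype.val_injective.injOn

theorem summable_absNorm_rpow {s : ℝ} (hs : 1 < s) :
    Summable fun I : (Ideal (𝓞 K))⁰ ↦ (Ideal.absNorm (I : Ideal (𝓞 K)) : ℝ) ^ (-s) :=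
  summable_rpow_of_tendsto_card (fun I ↦ Ideal.absNorm_ne_zero_of_nonZeroDivisors I)
    (Ideal.finite_absNorm_nonZeroDivisors_eq K) (NumberField.Ideal.tendsto_norm_le_div_atTop₀ K) hs

theorem tendsto_sub_one_mul_tsum_absNorm_rpow :
    Tendsto (fun s : ℝ ↦
      (s - 1) * ∑' I : (Ideal (𝓞 K))⁰, (Ideal.absNorm (I : Ideal (𝓞 K)) : ℝ) ^ (-s))
      (𝓝[>] 1) (𝓝 (dedekindZeta_residue K)) :=
  tendsto_sub_one_mul_tsum_rpow (fun I ↦ Ideal.absNorm_ne_zero_of_nonZeroDivisors I)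
    (Ideal.finite_absNorm_nonZeroDivisors_eq K) (NumberField.Ideal.tendsto_norm_le_div_atTop₀ K)

theorem exists_tendsto_sub_one_mul_tsum_mk0_eq :
    ∃ l : ℝ, ∀ C : ClassGroup (𝓞 K), Tendsto (fun s : ℝ ↦
      (s - 1) * ∑' I : {I : (Ideal (𝓞 K))⁰ // ClassGroup.mk0 I = C},
        (Ideal.absNorm (I.1 : Ideal (𝓞 K)) : ℝ) ^ (-s)) (𝓝[>] 1) (𝓝 l) := by
  refine ⟨_, fun C ↦ tendsto_sub_one_mul_tsum_rpow
    (N := fun I : {I : (Ideal (𝓞 K))⁰ // ClassGroup.mk0 I = C} ↦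
      Ideal.absNorm (I.1 : Ideal (𝓞 K)))
    (fun I ↦ Ideal.absNorm_ne_zero_of_nonZeroDivisors I.1)
    (fun n ↦ (Ideal.finite_absNorm_nonZeroDivisors_eq K n).preimage
      Subtype.val_injective.injOn)
    ((NumberField.Ideal.tendsto_norm_le_and_mk_eq_div_atTop K C).congr fun x ↦ ?_)⟩
  rw [Nat.card_congr ((Equiv.subtypeEquivRight fun I ↦ and_comm).trans
    (Equiv.subtypeSubtypeEquivSubtypeInter _ _).symm)]

end IdealSum

section ChiThree

/-- The nontrivial quadratic character modulo `3`, with real values. -/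
noncomputable def chiThree (n : ℤ) : ℝ := ((quadraticChar (ZMod 3) (n : ZMod 3) : ℤ) : ℝ)

theorem chiThree_mul (m n : ℤ) : chiThree (m * n) = chiThree m * chiThree n := by
  rw [chiThree, Int.cast_mul, map_mul, Int.cast_mul, chiThree, chiThree]

theorem chiThree_zero : chiThree 0 = 0 := by simp [chiThree]

theorem chiThree_one : chiThree 1 = 1 := by simp [chiThree]

theorem chiThree_congr {m n : ℤ} (h : (m : ZMod 3) = n) : chiThree m = chiThree n := by
  rw [chiThree, h, chiThree]

theorem chiThree_of_eq_one {n : ℤ} (h : (n : ZMod 3) = 1) : chiThree n = 1 := by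
  simp [chiThree, h]

theorem chiThree_of_eq_two {n : ℤ} (h : (n : ZMod 3) = 2) : chiThree n = -1 := by
  rw [chiThree, h, show quadraticChar (ZMod 3) 2 = -1 by decide]
  simp

theorem abs_chiThree_le_one (n : ℤ) : |chiThree n| ≤ 1 := by
  have h : ∀ x : ZMod 3, |quadraticChar (ZMod 3) x| ≤ 1 := by decide
  rw [chiThree]
  exact_mod_cast h n

theorem chiThree_neg (n : ℤ) : chiThree (-n) = -chiThree n := by
  have h : ∀ x : ZMod 3, quadraticChar (ZMod 3) (-x) = -quadraticChar (ZMod 3) x := by decide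
  simp [chiThree, h]

theorem chiThree_natAbs (n : ℤ) :
    chiThree n.natAbs = (SignType.sign (n : ℝ) : ℝ) * chiThree n := by
  rcases lt_trichotomy n 0 with h | rfl | h
  · rw [Int.ofNat_natAbs_of_nonpos h.le, chiThree_neg, sign_neg (Int.cast_lt_zero.mpr h)]
    simp
  · simp [chiThree_zero]
  · rw [Int.natAbs_of_nonneg h.le, sign_pos (Int.cast_pos.mpr h)]
    simp

end ChiThree

section Generators
open nonZeroDivisors

variable {K : Type*} [Field K] [NumberField K]

theorem exists_generator_of_mk0_eq (C : ClassGroup (𝓞 K)) :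
    ∃ (J : (Ideal (𝓞 K))⁰)
      (a : {I : (Ideal (𝓞 K))⁰ // ClassGroup.mk0 I = C} → (J : Ideal (𝓞 K))),
      (∀ I, Ideal.span {(a I : 𝓞 K)} = I.1 * (J : Ideal (𝓞 K))) ∧
      (Function.Injective fun p : {I : (Ideal (𝓞 K))⁰ // ClassGroup.mk0 I = C} × (𝓞 K)ˣ ↦
        (p.2 : 𝓞 K) • a p.1) ∧
      ∀ x : (J : Ideal (𝓞 K)), x ≠ 0 → ∃ p : _ × (𝓞 K)ˣ, (p.2 : 𝓞 K) • a p.1 = x := by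
  obtain ⟨J, hJ⟩ := ClassGroup.mk0_surjective C⁻¹
  have hJ0 : (J : Ideal (𝓞 K)) ≠ 0 := nonZeroDivisors.coe_ne_zero J
  have h1 : ∀ I : {I : (Ideal (𝓞 K))⁰ // ClassGroup.mk0 I = C},
      ∃ a : (J : Ideal (𝓞 K)), Ideal.span {(a : 𝓞 K)} = I.1 * (J : Ideal (𝓞 K)) := by
    intro I
    have : ClassGroup.mk0 (I.1 * J) = 1 := by rw [map_mul, I.2, hJ, mul_inv_cancel]
    obtain ⟨x, hx⟩ := (ClassGroup.mk0_eq_one_iff (I.1 * J).2).mp this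
    have hx' : Ideal.span {x} = I.1 * (J : Ideal (𝓞 K)) := hx.symm
    have hxJ : Ideal.span {x} ≤ (J : Ideal (𝓞 K)) := hx'.trans_le Ideal.mul_le_right
    exact ⟨⟨x, hxJ (Ideal.mem_span_singleton_self x)⟩, hx'⟩
  choose a ha using h1
  have ha0 : ∀ I, (a I : 𝓞 K) ≠ 0 := by
    intro I h
    have hI : (I.1 : Ideal (𝓞 K)) ≠ 0 := nonZeroDivisors.coe_ne_zero I.1
    have hs : Ideal.span {(a I : 𝓞 K)} = 0 := Ideal.span_singleton_eq_bot.mpr h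
    rw [ha] at hs
    exact mul_ne_zero hI hJ0 hs
  refine ⟨J, a, ha, ?_, fun x hx ↦ ?_⟩
  · rintro ⟨I, u⟩ ⟨I', u'⟩ h
    have h' : (u : 𝓞 K) * a I = u' * a I' := congrArg Subtype.val h
    have h2 : Ideal.span {(a I : 𝓞 K)} = Ideal.span {(a I' : 𝓞 K)} := by
      rw [← Ideal.span_singleton_mul_left_unit u.isUnit, h',
        Ideal.span_singleton_mul_left_unit u'.isUnit]
    rw [ha, ha] at h2
    obtain rfl : I = I' := Subtype.ext (Subtype.ext (mul_right_cancel₀ hJ0 h2))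
    exact Prod.ext rfl (Units.ext (mul_right_cancel₀ (ha0 I) h'))
  · have hx0 : (x : 𝓞 K) ≠ 0 := fun h ↦ hx (Subtype.ext h)
    obtain ⟨I, hI⟩ := Ideal.dvd_span_singleton.mpr x.2
    have hI0 : I ≠ 0 := by
      rintro rfl
      rw [mul_zero, Ideal.zero_eq_bot, Ideal.span_singleton_eq_bot] at hI
      exact hx0 hI
    let I' : (Ideal (𝓞 K))⁰ := ⟨I, mem_nonZeroDivisors_of_ne_zero hI0⟩
    have hI' : ClassGroup.mk0 I' = C := by
      have : ClassGroup.mk0 (J * I') = 1 :=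
        (ClassGroup.mk0_eq_one_iff (J * I').2).mpr ⟨x, hI.symm⟩
      rwa [map_mul, hJ, inv_mul_eq_one, eq_comm] at this
    have h3 : Ideal.span {(a ⟨I', hI'⟩ : 𝓞 K)} = Ideal.span {(x : 𝓞 K)} := by
      rw [ha, hI, mul_comm]
    obtain ⟨u, hu⟩ := Ideal.span_singleton_eq_span_singleton.mp h3
    exact ⟨(⟨I', hI'⟩, u), Subtype.ext (by rw [← hu, mul_comm]; rfl)⟩

end Generators

section ClassSum
open Module NumberField.InfinitePlace NumberField.Units nonZeroDivisors
open NumberField.mixedEmbedding.fundamentalCone (completeBasis)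

variable {K : Type*} [Field K] [IsTotallyReal K]

theorem exp_mul_oddWeight_realEmbedding [NumberField K] (s : ℝ) (k : ℤ) {x : 𝓞 K} (hx : x ≠ 0) :
    Real.exp (-s * (Fintype.card (InfinitePlace K) * k)) *
      oddWeight (completeBasis K) s ((Real.exp k)⁻¹ • realEmbedding K x) =
    (SignType.sign (Algebra.norm ℤ x : ℝ) : ℝ) * (((Algebra.norm ℤ x).natAbs : ℝ) ^ (-s) *
      logTent (completeBasis K) fun w ↦ Real.log (w (x : K)) - k) := by
  have hx' : (x : K) ≠ 0 := RingOfIntegers.coe_ne_zero_iff.mpr hx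
  have h0 : ∀ w : InfinitePlace K, realEmbedding K x w ≠ 0 := fun w h ↦ by
    have := abs_realEmbedding (x : K) w
    rw [h, abs_zero, eq_comm, map_eq_zero] at this
    exact hx' this
  have hlog : ∀ w : InfinitePlace K,
      Real.log (((Real.exp k)⁻¹ • realEmbedding K x) w) = Real.log (w (x : K)) - k := by
    intro w
    rw [Pi.smul_apply, smul_eq_mul, Real.log_mul (by positivity) (h0 w), Real.log_inv,
      Real.log_exp, ← Real.log_abs, abs_realEmbedding]
    ring
  have hsign : ∏ w, (SignType.sign (((Real.exp k)⁻¹ • realEmbedding K x) w) : ℝ) =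
      (SignType.sign (Algebra.norm ℤ x : ℝ) : ℝ) := by
    rw [← prod_realEmbedding_int]
    refine Eq.trans (Finset.prod_congr rfl fun w _ ↦ ?_)
      (map_prod ((SignType.castHom (α := ℝ)).comp (signHom (α := ℝ))) _ _).symm
    rw [Pi.smul_apply, smul_eq_mul, sign_mul, sign_pos (by positivity), one_mul]
    rfl
  have hsum : ∑ w : InfinitePlace K, (Real.log (w (x : K)) - k) =
      Real.log ((Algebra.norm ℤ x).natAbs : ℝ) - Fintype.card (InfinitePlace K) * k := by
    rw [Finset.sum_sub_distrib, Finset.sum_const, Finset.card_univ, nsmul_eq_mul, Nat.cast_natAbs,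
      Int.cast_abs, ← prod_realEmbedding_int, Finset.abs_prod, Real.log_prod fun w _ ↦
      abs_ne_zero.mpr (h0 w)]
    simp only [abs_realEmbedding]
  have hpos : (0 : ℝ) < (Algebra.norm ℤ x).natAbs := by
    rw [Nat.cast_pos, Int.natAbs_pos, Algebra.norm_ne_zero_iff]
    exact hx
  simp only [oddWeight]
  simp only [hlog]
  rw [hsign, hsum, Real.rpow_def_of_pos hpos, mul_left_comm, ← mul_assoc (Real.exp _),
    ← Real.exp_add]
  congr 3
  ring_nf

theorem sum_smul_realEmbedding {J : Ideal (𝓞 K)} {κ : Type*} [Fintype κ] (bJ : Basis κ ℤ J)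
    {b : Basis κ ℝ (InfinitePlace K → ℝ)} (hb : ∀ i, b i = realEmbedding K (bJ i : 𝓞 K))
    (m : κ → ℤ) :
    ∑ i, (m i : ℝ) • b i = realEmbedding K (bJ.equivFun.symm m : 𝓞 K) := by
  rw [Basis.equivFun_symm_apply]
  simp only [AddSubmonoidClass.coe_finsetSum, map_sum, hb]
  refine Finset.sum_congr rfl fun i _ ↦ ?_
  ext w
  simp

theorem exists_bound_abs_tsum_generator [NumberField K] (C : ClassGroup (𝓞 K)) :
    ∃ (J : (Ideal (𝓞 K))⁰)
      (a : {I : (Ideal (𝓞 K))⁰ // ClassGroup.mk0 I = C} → 𝓞 K) (D : ℝ),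
      (∀ I, Ideal.span {a I} = I.1 * (J : Ideal (𝓞 K))) ∧
      ∀ s ∈ Set.Icc (1 : ℝ) 2, ∀ k : ℤ,
        |∑' p : {I : (Ideal (𝓞 K))⁰ // ClassGroup.mk0 I = C} × (𝓞 K)ˣ,
          chiThree (Ideal.absNorm (p.1.1 : Ideal (𝓞 K))) *
            (((Algebra.norm ℤ (a p.1)).natAbs : ℝ) ^ (-s) *
              logTent (completeBasis K) fun w ↦
                Real.log (w (a p.1 : K)) + (Real.log (w (p.2 : K)) - k))| ≤
          D * Real.exp (-|(k : ℝ)|) := by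
  classical
  obtain ⟨J, a, ha, hinj, hsurj⟩ := exists_generator_of_mk0_eq C
  have hJ : (J : Ideal (𝓞 K)) ≠ ⊥ := nonZeroDivisors.coe_ne_zero J
  let bJ := Ideal.selfBasis (RingOfIntegers.basis K) (J : Ideal (𝓞 K)) hJ
  obtain ⟨b, hb⟩ := exists_basis_realEmbedding hJ bJ
  obtain ⟨d, D₀, hd, hnorm, hper⟩ := exists_norm_eq_mul_det (RingOfIntegers.basis K) bJ
  have hd0 : d ≠ 0 := by
    rw [← Int.natAbs_ne_zero, hd]
    exact Ideal.absNorm_ne_zero_of_nonZeroDivisors J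
  have hb' := sum_smul_realEmbedding bJ hb
  let f : (Free.ChooseBasisIndex ℤ (𝓞 K) → ℤ) → ℝ :=
    fun m ↦ (SignType.sign (d : ℝ) : ℝ) * chiThree (D₀ m)
  have hf0 : ∀ m, f m ≠ 0 → Algebra.norm ℤ (bJ.equivFun.symm m : 𝓞 K) ≠ 0 := by
    intro m hm h
    rw [hnorm, mul_eq_zero, or_iff_right hd0] at h
    exact hm (by simp only [f, h, chiThree_zero, mul_zero])
  obtain ⟨D, hD⟩ := exists_bound_abs_tsum_oddWeight (completeBasis K) b f
    (fun m q ↦ by simp only [f, chiThree_congr (hper m q)]) fun m hm ↦ by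
      rw [hb', ← Finset.abs_prod, prod_realEmbedding_int]
      exact_mod_cast Int.one_le_abs (hf0 m hm)
  refine ⟨J, fun I ↦ a I, D, ha, fun s hs k ↦ (Eq.le ?_).trans (hD s hs k)⟩
  rw [← tsum_mul_left]
  congr 1
  rw [← (bJ.equivFun.injective.comp hinj).tsum_eq]
  · refine tsum_congr fun p ↦ ?_
    have ha0 : (a p.1 : 𝓞 K) ≠ 0 := by
      intro h
      have h1 : (p.1.1 : Ideal (𝓞 K)) ≠ 0 := nonZeroDivisors.coe_ne_zero p.1.1
      have h2 := ha p.1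
      rw [h, Ideal.span_singleton_eq_bot.mpr rfl] at h2
      exact mul_ne_zero h1 hJ h2.symm
    have hg : bJ.equivFun.symm ((bJ.equivFun ∘ fun p ↦ (p.2 : 𝓞 K) • a p.1) p) =
        (p.2 : 𝓞 K) • a p.1 := bJ.equivFun.symm_apply_apply _
    set m := (bJ.equivFun ∘ fun p ↦ (p.2 : 𝓞 K) • a p.1) p
    have hm := hnorm m
    have hua : ((bJ.equivFun.symm m : (J : Ideal (𝓞 K))) : 𝓞 K) = p.2 * a p.1 := by
      rw [hg]; rfl
    have hu : (Algebra.norm ℤ (p.2 : 𝓞 K)).natAbs = 1 :=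
      Int.isUnit_iff_natAbs_eq.mp (p.2.isUnit.map _)
    have hnua : (Algebra.norm ℤ (p.2 * a p.1 : 𝓞 K)).natAbs =
        (Algebra.norm ℤ (a p.1 : 𝓞 K)).natAbs := by
      rw [map_mul, Int.natAbs_mul, hu, one_mul]
    have hD₀ : (D₀ m).natAbs = Ideal.absNorm (p.1.1 : Ideal (𝓞 K)) := by
      have h := congrArg Ideal.absNorm (ha p.1)
      rw [Ideal.absNorm_span_singleton, map_mul, ← hnua, ← hua, hm, Int.natAbs_mul, hd,
        mul_comm] at h
      exact mul_right_cancel₀ (Ideal.absNorm_ne_zero_of_nonZeroDivisors J) h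
    have hsd : (SignType.sign (d : ℝ) : ℝ) * SignType.sign (d : ℝ) = 1 := by
      rcases hd0.lt_or_gt with h | h
      · simp [sign_neg (Int.cast_lt_zero.mpr h : (d : ℝ) < 0)]
      · simp [sign_pos (Int.cast_pos.mpr h : 0 < (d : ℝ))]
    have hsign : (SignType.sign ((d * D₀ m : ℤ) : ℝ) : ℝ) =
        (SignType.sign (d : ℝ) : ℝ) * SignType.sign (D₀ m : ℝ) := by
      rw [Int.cast_mul, sign_mul, SignType.coe_mul]
    have hlog : ∀ w : InfinitePlace K, Real.log (w ((p.2 * a p.1 : 𝓞 K) : K)) - k =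
        Real.log (w ((a p.1 : 𝓞 K) : K)) + (Real.log (w (p.2 : K)) - k) := by
      intro w
      have h : ((p.2 * a p.1 : 𝓞 K) : K) = (p.2 : K) * ((a p.1 : 𝓞 K) : K) :=
        map_mul (algebraMap (𝓞 K) K) _ _
      rw [h, map_mul, Real.log_mul]
      · ring
      · exact (map_ne_zero w).mpr (coe_ne_zero p.2)
      · exact (map_ne_zero w).mpr (RingOfIntegers.coe_ne_zero_iff.mpr ha0)
    rw [mul_left_comm (Real.exp _), hb', hua,
      exp_mul_oddWeight_realEmbedding s k (mul_ne_zero p.2.ne_zero ha0), hnua, ← hua, hm, hsign,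
      hua, ← hD₀, chiThree_natAbs]
    simp only [hlog, f]
    linear_combination -(SignType.sign (D₀ m : ℝ) : ℝ) * chiThree (D₀ m) *
      (((Algebra.norm ℤ (a p.1 : 𝓞 K)).natAbs : ℝ) ^ (-s) *
        logTent (completeBasis K) fun w ↦
          Real.log (w ((a p.1 : 𝓞 K) : K)) + (Real.log (w (p.2 : K)) - k)) * hsd
  · intro m hm
    have hfm : f m ≠ 0 := left_ne_zero_of_mul (right_ne_zero_of_mul hm)
    obtain ⟨p, hp⟩ := hsurj (bJ.equivFun.symm m) fun h ↦ hf0 m hfm (by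
      rw [h, Submodule.coe_zero, Algebra.norm_zero])
    exact ⟨p, (LinearEquiv.symm_apply_eq _).mp hp.symm ▸ rfl⟩

end ClassSum

section ClassBound
open Module NumberField.InfinitePlace NumberField.Units nonZeroDivisors
open NumberField.mixedEmbedding.fundamentalCone (completeBasis)

theorem abs_tsum_mul_le {α β γ : Type*} {c : α → ℝ} {t : α → β × γ → ℝ} {T : ℝ} {B : γ → ℝ}
    (hc : Summable c) (ht : ∀ a p, 0 ≤ t a p) (hT : ∀ a, HasSum (t a) T) (hB : Summable B)
    (h : ∀ k, |∑' p : α × β, c p.1 * t p.1 (p.2, k)| ≤ B k) :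
    |(∑' a, c a) * T| ≤ ∑' k, B k := by
  have hs : Summable fun q : α × (β × γ) ↦ c q.1 * t q.1 q.2 := by
    refine Summable.of_norm ?_
    simp only [norm_mul, Real.norm_eq_abs, abs_of_nonneg (ht _ _)]
    have h0 : 0 ≤ fun q : α × (β × γ) ↦ |c q.1| * t q.1 q.2 :=
      fun q ↦ mul_nonneg (abs_nonneg _) (ht _ _)
    refine (summable_prod_of_nonneg h0).mpr ⟨fun a ↦ (hT a).summable.mul_left |c a|, ?_⟩
    exact (hc.abs.mul_right T).congr fun a ↦ ((hT a).mul_left |c a|).tsum_eq.symm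
  have h1 : ∑' q : α × (β × γ), c q.1 * t q.1 q.2 = (∑' a, c a) * T := by
    rw [hs.tsum_prod, ← tsum_mul_right]
    exact tsum_congr fun a ↦ ((hT a).mul_left (c a)).tsum_eq
  let e : γ × (α × β) ≃ α × (β × γ) := (Equiv.prodComm _ _).trans (Equiv.prodAssoc α β γ)
  have h2 : ∑' r : γ × (α × β), c (e r).1 * t (e r).1 (e r).2 =
      ∑' k, ∑' p : α × β, c p.1 * t p.1 (p.2, k) :=
    Summable.tsum_prod (e.summable_iff.mpr hs)
  rw [← h1, ← e.tsum_eq, h2, ← Real.norm_eq_abs]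
  exact tsum_of_norm_bounded hB.hasSum h

theorem summable_exp_neg_abs_intCast : Summable fun k : ℤ ↦ Real.exp (-|(k : ℝ)|) := by
  have h : Summable fun n : ℕ ↦ Real.exp (-(n : ℝ)) := Real.summable_exp_neg_nat
  exact Summable.of_nat_of_neg (by simpa using h) (by simpa using h)

variable (K : Type*) [Field K] [NumberField K] [IsTotallyReal K]

theorem exists_bound_abs_tsum_chiThree_mk0_eq (C : ClassGroup (𝓞 K)) :
    ∃ D : ℝ, ∀ s ∈ Set.Ioc (1 : ℝ) 2,
      |∑' I : {I : (Ideal (𝓞 K))⁰ // ClassGroup.mk0 I = C},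
        chiThree (Ideal.absNorm (I.1 : Ideal (𝓞 K))) *
          (Ideal.absNorm (I.1 : Ideal (𝓞 K)) : ℝ) ^ (-s)| ≤ D := by
  obtain ⟨J, a, D, ha, hD⟩ := exists_bound_abs_tsum_generator C
  have hJ : (1 : ℝ) ≤ Ideal.absNorm (J : Ideal (𝓞 K)) := by
    exact_mod_cast Nat.one_le_iff_ne_zero.mpr (Ideal.absNorm_ne_zero_of_nonZeroDivisors J)
  set E := ∑' k : ℤ, D * Real.exp (-|(k : ℝ)|)
  refine ⟨(Ideal.absNorm (J : Ideal (𝓞 K)) : ℝ) ^ (2 : ℝ) * E, fun s hs ↦ ?_⟩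
  have hn : ∀ I, ((Algebra.norm ℤ (a I)).natAbs : ℝ) ^ (-s) =
      (Ideal.absNorm (I.1 : Ideal (𝓞 K)) : ℝ) ^ (-s) *
        (Ideal.absNorm (J : Ideal (𝓞 K)) : ℝ) ^ (-s) := by
    intro I
    rw [← Ideal.absNorm_span_singleton, ha, map_mul, Nat.cast_mul,
      Real.mul_rpow (Nat.cast_nonneg _) (Nat.cast_nonneg _)]
  set S := ∑' I : {I : (Ideal (𝓞 K))⁰ // ClassGroup.mk0 I = C},
    chiThree (Ideal.absNorm (I.1 : Ideal (𝓞 K))) * (Ideal.absNorm (I.1 : Ideal (𝓞 K)) : ℝ) ^ (-s)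
    with hS
  have hsum : Summable fun I : {I : (Ideal (𝓞 K))⁰ // ClassGroup.mk0 I = C} ↦
      chiThree (Ideal.absNorm (I.1 : Ideal (𝓞 K))) *
        (Ideal.absNorm (I.1 : Ideal (𝓞 K)) : ℝ) ^ (-s) := by
    refine Summable.of_norm_bounded
      ((summable_absNorm_rpow K hs.1).comp_injective Subtype.val_injective) fun I ↦ ?_
    rw [norm_mul, Real.norm_eq_abs, Real.norm_of_nonneg (by positivity)]
    exact mul_le_of_le_one_left (by positivity) (abs_chiThree_le_one _)
  have h1 := abs_tsum_mul_le
    (c := fun I : {I : (Ideal (𝓞 K))⁰ // ClassGroup.mk0 I = C} ↦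
      chiThree (Ideal.absNorm (I.1 : Ideal (𝓞 K))) * ((Algebra.norm ℤ (a I)).natAbs : ℝ) ^ (-s))
    (t := fun I (p : (𝓞 K)ˣ × ℤ) ↦ logTent (completeBasis K) fun w ↦
      Real.log (w (a I : K)) + (Real.log (w (p.1 : K)) - p.2))
    (by simpa only [hn, ← mul_assoc] using hsum.mul_right _)
    (fun _ _ ↦ logTent_nonneg _ _) (fun I ↦ hasSum_logTent_units K _)
    (summable_exp_neg_abs_intCast.mul_left D) fun k ↦ by
      simpa only [mul_assoc] using hD s ⟨hs.1.le, hs.2⟩ k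
  simp only [hn, ← mul_assoc, tsum_mul_right] at h1
  rw [← hS, abs_mul, abs_mul, Nat.abs_cast,
    abs_of_nonneg (Real.rpow_nonneg (Nat.cast_nonneg _) _)] at h1
  have hE : 0 ≤ E := le_trans (by positivity) h1
  have hT : (1 : ℝ) ≤ torsionOrder K := by
    exact_mod_cast Nat.one_le_iff_ne_zero.mpr (torsionOrder_ne_zero K)
  have h2 : |S| * (Ideal.absNorm (J : Ideal (𝓞 K)) : ℝ) ^ (-s) ≤ E :=
    (le_mul_of_one_le_right (by positivity) hT).trans h1
  rw [Real.rpow_neg (by positivity), ← div_eq_mul_inv, div_le_iff₀' (by positivity)] at h2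
  exact h2.trans (mul_le_mul_of_nonneg_right (Real.rpow_le_rpow_of_exponent_le hJ hs.2) hE)

end ClassBound

section EulerProduct
open Filter Topology

variable {M σ : Type*} [CommMonoid M] {π : σ → M} (F : M →* ℝ)

open scoped Classical in
theorem prod_one_sub_mul_tsum (hinj : ∀ p, Function.Injective (π p * ·))
    (hprime : ∀ p a b, π p ∣ a * b → π p ∣ a ∨ π p ∣ b) (hdist : ∀ p q, π p ∣ π q → p = q)
    (hF : Summable F) (S : Finset σ) :
    (∏ p ∈ S, (1 - F (π p))) * ∑' a, F a = ∑' a, if ∀ p ∈ S, ¬ π p ∣ a then F a else 0 := by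
  have hsum : ∀ (P : M → Prop) [DecidablePred P], Summable fun a ↦ if P a then F a else 0 :=
    fun P _ ↦ hF.norm.of_norm_bounded fun a ↦ by split_ifs <;> simp
  induction S using Finset.induction_on with
  | empty => simp
  | insert p S hp ih =>
    rw [Finset.prod_insert hp, mul_assoc, ih, sub_mul, one_mul, sub_eq_iff_eq_add, ← tsum_mul_left]
    have h1 : ∀ a, F (π p) * (if ∀ q ∈ S, ¬ π q ∣ a then F a else 0) =
        if (∀ q ∈ S, ¬ π q ∣ π p * a) ∧ π p ∣ π p * a then F (π p * a) else 0 := by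
      intro a
      have : (∀ q ∈ S, ¬ π q ∣ π p * a) ↔ ∀ q ∈ S, ¬ π q ∣ a := by
        refine forall₂_congr fun q hq ↦ not_congr ⟨fun h ↦ ?_, fun h ↦ h.mul_left _⟩
        exact (hprime q _ _ h).resolve_left fun h' ↦ hp (hdist q p h' ▸ hq)
      simp only [this, dvd_mul_right, and_true, mul_ite, map_mul, mul_zero]
    rw [tsum_congr h1, (hinj p).tsum_eq
      (f := fun a ↦ if (∀ q ∈ S, ¬ π q ∣ a) ∧ π p ∣ a then F a else 0)]
    · refine Eq.trans (tsum_congr fun a ↦ ?_) ((hsum _).tsum_add (hsum _))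
      simp only [Finset.forall_mem_insert]
      split_ifs <;> simp_all
    · intro a ha
      obtain ⟨b, rfl⟩ := (of_not_not fun h ↦ ha (if_neg h) : _ ∧ π p ∣ a).2
      exact ⟨b, rfl⟩

theorem tendsto_prod_one_sub_mul_tsum (hinj : ∀ p, Function.Injective (π p * ·))
    (hprime : ∀ p a b, π p ∣ a * b → π p ∣ a ∨ π p ∣ b) (hdist : ∀ p q, π p ∣ π q → p = q)
    (hone : ∀ p, ¬ π p ∣ 1) (hF : Summable F) {ι : Type*} {l : Filter ι} {S : ι → Finset σ}
    (hS : ∀ a ≠ 1, ∀ᶠ i in l, ∃ p ∈ S i, π p ∣ a) :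
    Tendsto (fun i ↦ (∏ p ∈ S i, (1 - F (π p))) * ∑' a, F a) l (𝓝 1) := by
  classical
  simp only [prod_one_sub_mul_tsum F hinj hprime hdist hF]
  have h1 : ∑' a : M, (if a = 1 then (1 : ℝ) else 0) = 1 := tsum_ite_eq 1 _
  rw [← h1]
  refine tendsto_tsum_of_dominated_convergence hF.norm (fun a ↦ ?_)
    (Eventually.of_forall fun i a ↦ by split_ifs <;> simp)
  refine tendsto_const_nhds.congr' ?_
  split_ifs with h
  · subst h
    exact Eventually.of_forall fun i ↦ ((if_pos fun p _ ↦ hone p).trans (map_one F)).symm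
  · filter_upwards [hS a h] with i ⟨p, hp, hpa⟩
    exact (if_neg fun h' ↦ h' p hp hpa).symm

end EulerProduct

section PrimesOver
open IsDedekindDomain Module

variable {K L : Type*} [Field K] [NumberField K] [Field L] [NumberField L] [Algebra K L]

theorem finite_setOf_under_eq (v : HeightOneSpectrum (𝓞 K)) :
    {w : HeightOneSpectrum (𝓞 L) | w.under (𝓞 K) = v}.Finite := by
  refine Set.Finite.of_finite_image (f := HeightOneSpectrum.asIdeal) ?_
    fun _ _ _ _ h ↦ HeightOneSpectrum.ext h
  refine (IsDedekindDomain.primesOver_finite v.asIdeal (𝓞 L)).subset ?_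
  rintro _ ⟨w, hw, rfl⟩
  exact ⟨w.isPrime, ⟨(congrArg HeightOneSpectrum.asIdeal hw).symm⟩⟩

variable (L) in
/-- The primes of `L` lying over a given prime of `K`. -/
noncomputable def primesAbove (v : HeightOneSpectrum (𝓞 K)) : Finset (HeightOneSpectrum (𝓞 L)) :=
  (finite_setOf_under_eq v).toFinset

theorem mem_primesAbove {v : HeightOneSpectrum (𝓞 K)} {w : HeightOneSpectrum (𝓞 L)} :
    w ∈ primesAbove L v ↔ w.under (𝓞 K) = v := by
  simp [primesAbove]

theorem under_asIdeal_of_mem {v : HeightOneSpectrum (𝓞 K)} {w : HeightOneSpectrum (𝓞 L)}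
    (hw : w ∈ primesAbove L v) : w.asIdeal.under (𝓞 K) = v.asIdeal :=
  congrArg HeightOneSpectrum.asIdeal (mem_primesAbove.mp hw)

theorem map_le_of_mem_primesAbove {v : HeightOneSpectrum (𝓞 K)} {w : HeightOneSpectrum (𝓞 L)}
    (hw : w ∈ primesAbove L v) : v.asIdeal.map (algebraMap (𝓞 K) (𝓞 L)) ≤ w.asIdeal :=
  Ideal.map_le_iff_le_comap.mpr (under_asIdeal_of_mem hw).ge

theorem relNorm_of_mem_primesAbove {v : HeightOneSpectrum (𝓞 K)} {w : HeightOneSpectrum (𝓞 L)}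
    (hw : w ∈ primesAbove L v) :
    Ideal.relNorm (𝓞 K) w.asIdeal = v.asIdeal ^ w.asIdeal.inertiaDeg (𝓞 K) := by
  have : w.asIdeal.LiesOver v.asIdeal := ⟨(under_asIdeal_of_mem hw).symm⟩
  have := w.isMaximal
  have := v.isMaximal
  exact Ideal.relNorm_eq_pow_of_isMaximal w.asIdeal v.asIdeal

theorem absNorm_of_mem_primesAbove {v : HeightOneSpectrum (𝓞 K)} {w : HeightOneSpectrum (𝓞 L)}
    (hw : w ∈ primesAbove L v) :
    Ideal.absNorm w.asIdeal = Ideal.absNorm v.asIdeal ^ w.asIdeal.inertiaDeg (𝓞 K) := by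
  rw [← map_pow, ← relNorm_of_mem_primesAbove hw, Ideal.absNorm_relNorm]

theorem one_lt_absNorm (v : HeightOneSpectrum (𝓞 K)) : 1 < Ideal.absNorm v.asIdeal := by
  have h0 : Ideal.absNorm v.asIdeal ≠ 0 := mt Ideal.absNorm_eq_zero_iff.mp v.ne_bot
  have h1 : Ideal.absNorm v.asIdeal ≠ 1 := mt Ideal.absNorm_eq_one_iff.mp v.isPrime.ne_top
  omega

theorem inertiaDeg_pos_of_heightOne (w : HeightOneSpectrum (𝓞 L)) :
    0 < w.asIdeal.inertiaDeg (𝓞 K) :=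
  have := w.isPrime
  Ideal.inertiaDeg_pos _ _

theorem relNorm_map_eq_sq (hLK : finrank K L = 2) (I : Ideal (𝓞 K)) :
    Ideal.relNorm (𝓞 K) (I.map (algebraMap (𝓞 K) (𝓞 L))) = I ^ 2 := by
  rw [Ideal.relNorm_algebraMap, ← hLK, IsFractionRing.finrank_eq (𝓞 K) K (𝓞 L) L]

theorem sum_inertiaDeg_primesAbove_le (hLK : finrank K L = 2) (v : HeightOneSpectrum (𝓞 K)) :
    ∑ w ∈ primesAbove L v, w.asIdeal.inertiaDeg (𝓞 K) ≤ 2 := by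
  have h : ∏ w ∈ primesAbove L v, w.asIdeal ∣ v.asIdeal.map (algebraMap (𝓞 K) (𝓞 L)) := by
    let e : HeightOneSpectrum (𝓞 L) ↪ Ideal (𝓞 L) :=
      ⟨HeightOneSpectrum.asIdeal, fun _ _ ↦ HeightOneSpectrum.ext⟩
    rw [show ∏ w ∈ primesAbove L v, w.asIdeal = ∏ I ∈ (primesAbove L v).map e, I from
      (Finset.prod_map (primesAbove L v) e id).symm]
    refine Finset.prod_primes_dvd _ (fun I hI ↦ ?_) fun I hI ↦ ?_ <;>
      obtain ⟨w, hw, rfl⟩ := Finset.mem_map.mp hI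
    · exact w.prime
    · exact Ideal.dvd_iff_le.mpr (map_le_of_mem_primesAbove hw)
  have h2 := map_dvd (Ideal.relNorm (𝓞 K)) h
  rw [relNorm_map_eq_sq hLK, map_prod,
    Finset.prod_congr rfl fun w hw ↦ relNorm_of_mem_primesAbove hw,
    Finset.prod_pow_eq_pow_sum] at h2
  exact (pow_dvd_pow_iff v.ne_bot v.prime.not_isUnit).mp h2

theorem map_eq_of_inertiaDeg_eq_two (hLK : finrank K L = 2) {v : HeightOneSpectrum (𝓞 K)}
    {w : HeightOneSpectrum (𝓞 L)} (hw : w ∈ primesAbove L v)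
    (h2 : w.asIdeal.inertiaDeg (𝓞 K) = 2) :
    v.asIdeal.map (algebraMap (𝓞 K) (𝓞 L)) = w.asIdeal := by
  obtain ⟨J, hJ⟩ := Ideal.dvd_iff_le.mpr (map_le_of_mem_primesAbove hw)
  have h := relNorm_map_eq_sq hLK v.asIdeal
  rw [hJ, map_mul, relNorm_of_mem_primesAbove hw, h2] at h
  have hJ1 : Ideal.relNorm (𝓞 K) J = 1 :=
    mul_left_cancel₀ (pow_ne_zero 2 v.ne_bot) (h.trans (mul_one _).symm)
  have hJ2 : J = 1 := by
    rw [Ideal.one_eq_top, ← Ideal.absNorm_eq_one_iff, ← Ideal.absNorm_relNorm (𝓞 K) (𝓞 L) J, hJ1,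
      map_one]
  rw [hJ, hJ2, mul_one]

theorem exists_mem_primesAbove (v : HeightOneSpectrum (𝓞 K)) : ∃ w, w ∈ primesAbove L v := by
  have := v.isMaximal
  obtain ⟨Q, hQ1, hQ2⟩ :=
    Ideal.exists_maximal_ideal_liesOver_of_isIntegral (S := 𝓞 L) v.asIdeal
  refine ⟨⟨Q, hQ1.isPrime, Ideal.ne_bot_of_mem_primesOver v.ne_bot ⟨hQ1.isPrime, hQ2⟩⟩, ?_⟩
  exact mem_primesAbove.mpr (HeightOneSpectrum.ext hQ2.over.symm)

end PrimesOver

section CubeRoot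
open IsDedekindDomain Module

theorem Algebra.trace_eq_zero_of_sq_eq {K L : Type*} [Field K] [Field L] [Algebra K L]
    [FiniteDimensional K L] {s : L} {a : K} (hs : s ^ 2 = algebraMap K L a)
    (ha : ∀ b, b ^ 2 ≠ a) : Algebra.trace K L s = 0 := by
  have h : minpoly K s = Polynomial.X ^ 2 - Polynomial.C a :=
    (minpoly.eq_of_irreducible_of_monic (X_pow_sub_C_irreducible_of_prime Nat.prime_two ha)
      (by simp [hs]) (Polynomial.monic_X_pow_sub_C a two_ne_zero)).symm
  rw [trace_eq_finrank_mul_minpoly_nextCoeff, h,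
    Polynomial.nextCoeff_of_natDegree_pos (by simp), Polynomial.natDegree_X_pow_sub_C]
  simp [Polynomial.coeff_X_pow]

variable {K L : Type*} [Field K] [NumberField K] [Field L] [NumberField L] [Algebra K L]

theorem intTrace_mem_of_mem_map {I : Ideal (𝓞 K)} {x : 𝓞 L}
    (hx : x ∈ I.map (algebraMap (𝓞 K) (𝓞 L))) : Algebra.intTrace (𝓞 K) (𝓞 L) x ∈ I := by
  suffices h : ∀ r, Algebra.intTrace (𝓞 K) (𝓞 L) (r * x) ∈ I by simpa using h 1
  refine Submodule.span_induction ?_ ?_ ?_ ?_ hx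
  · rintro _ ⟨y, hy, rfl⟩ r
    rw [mul_comm, ← Algebra.smul_def, map_smul, smul_eq_mul]
    exact I.mul_mem_right _ hy
  · simp
  · intro y z _ _ hy hz r
    rw [mul_add, map_add]
    exact I.add_mem (hy r) (hz r)
  · intro t y _ hy r
    rw [smul_eq_mul, ← mul_assoc]
    exact hy _

theorem intTrace_of_sq_add_self_add_one_eq_zero [IsTotallyReal K] (hLK : finrank K L = 2) {θ : 𝓞 L}
    (hθ : θ ^ 2 + θ + 1 = 0) : Algebra.intTrace (𝓞 K) (𝓞 L) θ = -1 := by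
  have hK : ∀ b : K, b ^ 2 ≠ -3 := by
    intro b hb
    have h := congrFun (congrArg (realEmbedding K) hb) (Classical.arbitrary _)
    rw [map_pow, map_neg, map_ofNat] at h
    exact absurd h (ne_of_gt ((by simp : -3 < (0 : ℝ)).trans_le (sq_nonneg _)))
  have hθ' : (θ : L) ^ 2 + θ + 1 = 0 := by exact_mod_cast congrArg (algebraMap (𝓞 L) L) hθ
  have h0 : Algebra.trace K L (2 * (θ : L) + 1) = 0 :=
    Algebra.trace_eq_zero_of_sq_eq (a := -3) (by
      simp only [map_neg, map_ofNat]; linear_combination 4 * hθ') hK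
  have h1 : Algebra.trace K L 1 = 2 := by
    have := Algebra.trace_algebraMap (S := L) (1 : K)
    simpa [hLK] using this
  have h2 : Algebra.trace K L (2 * (θ : L)) = 2 * Algebra.trace K L θ := by
    rw [two_mul, map_add, two_mul]
  apply RingOfIntegers.ext
  rw [map_add, h1, h2] at h0
  have h3 := Algebra.algebraMap_intTrace (A := 𝓞 K) (K := K) (L := L) θ
  refine h3.trans ?_
  push_cast
  linear_combination h0 / 2

theorem two_mul_add_one_mem_of_sub_mem_map [IsTotallyReal K] (hLK : finrank K L = 2) {θ : 𝓞 L}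
    (hθ : θ ^ 2 + θ + 1 = 0) {I : Ideal (𝓞 K)} {a : 𝓞 K}
    (h : algebraMap (𝓞 K) (𝓞 L) a - θ ∈ I.map (algebraMap (𝓞 K) (𝓞 L))) : 2 * a + 1 ∈ I := by
  have h1 := intTrace_mem_of_mem_map h
  have h2 : Algebra.intTrace (𝓞 K) (𝓞 L) (algebraMap (𝓞 K) (𝓞 L) a) = 2 * a := by
    apply RingOfIntegers.ext
    have h3 := Algebra.algebraMap_intTrace (A := 𝓞 K) (K := K) (L := L)
      (algebraMap (𝓞 K) (𝓞 L) a)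
    refine h3.trans ?_
    have := Algebra.trace_algebraMap (S := L) (a : K)
    rw [hLK, nsmul_eq_mul] at this
    rw [← IsScalarTower.algebraMap_apply, IsScalarTower.algebraMap_apply (𝓞 K) K L]
    exact_mod_cast this
  rwa [map_sub, h2, intTrace_of_sq_add_self_add_one_eq_zero hLK hθ, sub_neg_eq_add] at h1

theorem three_mem_or_exists_inertiaDeg_eq_one [IsTotallyReal K] (hLK : finrank K L = 2) {θ : 𝓞 L}
    (hθ : θ ^ 2 + θ + 1 = 0) {v : HeightOneSpectrum (𝓞 K)} {a : 𝓞 K}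
    (ha : a ^ 2 + a + 1 ∈ v.asIdeal) :
    3 ∈ v.asIdeal ∨ ∃ w ∈ primesAbove L v, w.asIdeal.inertiaDeg (𝓞 K) = 1 := by
  obtain ⟨w, hw⟩ := exists_mem_primesAbove (L := L) v
  have hpos := inertiaDeg_pos_of_heightOne (K := K) w
  have hle := (Finset.single_le_sum (fun w _ ↦ Nat.zero_le (w.asIdeal.inertiaDeg (𝓞 K))) hw).trans
    (sum_inertiaDeg_primesAbove_le hLK v)
  by_cases h1 : w.asIdeal.inertiaDeg (𝓞 K) = 1
  · exact .inr ⟨w, hw, h1⟩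
  left
  have hmap := map_eq_of_inertiaDeg_eq_two hLK hw (by omega)
  have hmem : (algebraMap (𝓞 K) (𝓞 L) a - θ) * (algebraMap (𝓞 K) (𝓞 L) (-1 - a) - θ) ∈
      w.asIdeal := by
    have := w.asIdeal.neg_mem (map_le_of_mem_primesAbove hw (Ideal.mem_map_of_mem _ ha))
    convert this using 1
    simp only [map_add, map_sub, map_neg, map_pow, map_one]
    linear_combination hθ
  have key : ∀ b : 𝓞 K, b ^ 2 + b + 1 ∈ v.asIdeal →
      algebraMap (𝓞 K) (𝓞 L) b - θ ∈ w.asIdeal → 3 ∈ v.asIdeal := by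
    intro b hb hbθ
    have h2 := two_mul_add_one_mem_of_sub_mem_map hLK hθ (hmap ▸ hbθ)
    have h3 := v.asIdeal.sub_mem (v.asIdeal.mul_mem_left 4 hb)
      (v.asIdeal.mul_mem_left (2 * b + 1) h2)
    convert h3 using 1
    ring
  rcases w.isPrime.mem_or_mem hmem with h | h
  · exact key a ha h
  · exact key (-1 - a) (by convert ha using 1; ring) h

end CubeRoot

section ResidueField
open IsDedekindDomain Module

section FiniteField
variable {F : Type*} [Field F] [Finite F]

theorem three_eq_zero_of_dvd_card (h : 3 ∣ Nat.card F) : (3 : F) = 0 := by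
  have : Fact (Nat.Prime 3) := ⟨Nat.prime_three⟩
  obtain ⟨x, hx⟩ := exists_prime_addOrderOf_dvd_card' 3 h
  have hx0 : x ≠ 0 := by
    rintro rfl
    simp at hx
  have h3 := addOrderOf_nsmul_eq_zero x
  rw [hx, nsmul_eq_mul] at h3
  exact_mod_cast (mul_eq_zero.mp h3).resolve_right hx0

theorem exists_sq_add_self_add_one_eq_zero (h : Nat.card F % 3 = 1) :
    ∃ u : F, u ^ 2 + u + 1 = 0 := by
  have : Fact (Nat.Prime 3) := ⟨Nat.prime_three⟩
  have h3 : 3 ∣ Nat.card Fˣ := by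
    have := Nat.card_units F
    omega
  obtain ⟨u, hu⟩ := exists_prime_orderOf_dvd_card' 3 h3
  have hu1 : (u : F) - 1 ≠ 0 := by
    rw [sub_ne_zero, Ne, Units.val_eq_one]
    rintro rfl
    simp at hu
  have hu3 : (u : F) ^ 3 = 1 := by
    rw [← hu, ← Units.val_pow_eq_pow_val, pow_orderOf_eq_one, Units.val_one]
  refine ⟨u, (mul_eq_zero.mp ?_).resolve_left hu1⟩
  linear_combination hu3

theorem three_eq_zero_of_card_mod_three_eq_two (h : Nat.card F % 3 = 2) {u : F}
    (hu : u ^ 2 + u + 1 = 0) : (3 : F) = 0 := by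
  have : Fintype F := Fintype.ofFinite F
  have hu3 : u ^ 3 = 1 := by linear_combination (u - 1) * hu
  have hu0 : u ≠ 0 := by
    rintro rfl
    simp at hu
  obtain ⟨k, hk⟩ : ∃ k, Nat.card F - 1 = 3 * k + 1 := ⟨(Nat.card F - 2) / 3, by omega⟩
  have h1 := FiniteField.pow_card_sub_one_eq_one u hu0
  rw [← Nat.card_eq_fintype_card, hk, pow_succ, pow_mul, hu3, one_pow, one_mul] at h1
  rw [h1] at hu
  linear_combination hu

end FiniteField

variable {K : Type*} [Field K] [NumberField K] (v : HeightOneSpectrum (𝓞 K))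

theorem three_mem_of_three_dvd_absNorm (h : 3 ∣ Ideal.absNorm v.asIdeal) : 3 ∈ v.asIdeal := by
  have := v.isMaximal
  let := Ideal.Quotient.field v.asIdeal
  have := Ideal.finiteQuotientOfFreeOfNeBot v.asIdeal v.ne_bot
  have h3 : (3 : 𝓞 K ⧸ v.asIdeal) = 0 := three_eq_zero_of_dvd_card h
  exact Ideal.Quotient.eq_zero_iff_mem.mp h3

theorem exists_sq_add_self_add_one_mem (h : Ideal.absNorm v.asIdeal % 3 = 1) :
    ∃ a : 𝓞 K, a ^ 2 + a + 1 ∈ v.asIdeal := by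
  have := v.isMaximal
  let := Ideal.Quotient.field v.asIdeal
  have := Ideal.finiteQuotientOfFreeOfNeBot v.asIdeal v.ne_bot
  obtain ⟨u, hu⟩ := exists_sq_add_self_add_one_eq_zero (F := 𝓞 K ⧸ v.asIdeal) h
  obtain ⟨a, rfl⟩ := Ideal.Quotient.mk_surjective u
  exact ⟨a, Ideal.Quotient.eq_zero_iff_mem.mp hu⟩

theorem three_mem_of_absNorm_mod_three_eq_two (h : Ideal.absNorm v.asIdeal % 3 = 2) {θ : 𝓞 K}
    (hθ : θ ^ 2 + θ + 1 = 0) : 3 ∈ v.asIdeal := by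
  have := v.isMaximal
  let := Ideal.Quotient.field v.asIdeal
  have := Ideal.finiteQuotientOfFreeOfNeBot v.asIdeal v.ne_bot
  have h3 : (3 : 𝓞 K ⧸ v.asIdeal) = 0 := three_eq_zero_of_card_mod_three_eq_two h
    (u := Ideal.Quotient.mk v.asIdeal θ) (congrArg (Ideal.Quotient.mk v.asIdeal) hθ)
  exact Ideal.Quotient.eq_zero_iff_mem.mp h3

variable (K) in
theorem finite_setOf_three_mem : {v : HeightOneSpectrum (𝓞 K) | 3 ∈ v.asIdeal}.Finite := by
  have h0 : Ideal.span {(3 : 𝓞 K)} ≠ ⊥ := by simp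
  refine (Ideal.finite_factors h0).subset fun v hv ↦ ?_
  exact Ideal.dvd_span_singleton.mpr hv

end ResidueField

section LocalFactor

theorem prod_one_sub_pow_ge_of_eq_one {ι : Type*} {T : Finset ι} {f : ι → ℕ}
    (hpos : ∀ w ∈ T, 0 < f w) (hsum : ∑ w ∈ T, f w ≤ 2) {x : ℝ} (hx0 : 0 ≤ x) (hx1 : x ≤ 1) :
    (1 - x) ^ 2 ≤ ∏ w ∈ T, (1 - x ^ f w) := by
  have hcard : T.card ≤ 2 := by
    simpa using (T.card_nsmul_le_sum f 1 hpos).trans hsum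
  calc (1 - x) ^ 2 ≤ (1 - x) ^ T.card :=
        pow_le_pow_of_le_one (by linarith) (by linarith) hcard
    _ = ∏ w ∈ T, (1 - x) := (Finset.prod_const _).symm
    _ ≤ _ := Finset.prod_le_prod (fun _ _ ↦ by linarith) fun w hw ↦
        sub_le_sub_left (pow_le_of_le_one hx0 hx1 (hpos w hw).ne') 1

theorem prod_one_sub_pow_ge_of_eq_two {ι : Type*} {T : Finset ι} {f : ι → ℕ}
    (h2 : ∀ w ∈ T, f w = 2) (hsum : ∑ w ∈ T, f w ≤ 2) {x : ℝ} (hx0 : 0 ≤ x) (hx1 : x ≤ 1) :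
    1 - x ^ 2 ≤ ∏ w ∈ T, (1 - x ^ f w) := by
  rw [Finset.sum_congr rfl h2, Finset.sum_const, smul_eq_mul] at hsum
  have hcard : T.card ≤ 1 := by omega
  rw [Finset.prod_congr rfl fun w hw ↦ by rw [h2 w hw], Finset.prod_const]
  have hx2 := pow_le_one₀ (n := 2) hx0 hx1
  have := pow_le_pow_of_le_one (sub_nonneg.mpr hx2) (by linarith [sq_nonneg x]) hcard
  rwa [pow_one] at this

open IsDedekindDomain Module

variable {K L : Type*} [Field K] [NumberField K] [IsTotallyReal K] [Field L] [NumberField L]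
  [Algebra K L]

open scoped Classical in
theorem local_factor_le (hLK : finrank K L = 2) {θ : 𝓞 L} (hθ : θ ^ 2 + θ + 1 = 0)
    (v : HeightOneSpectrum (𝓞 K)) {ε x : ℝ} (hε : ε = 1 ∨ ε = -1)
    (hεL : ∀ w ∈ primesAbove L v, ε ^ w.asIdeal.inertiaDeg (𝓞 K) = 1) (hx0 : 0 ≤ x)
    (hx : x ≤ 1 / 2) :
    (if 3 ∈ v.asIdeal then 1 / 9 else 1) *
        ((1 - ε * x) * (1 - ε * chiThree (Ideal.absNorm v.asIdeal) * x)) ≤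
      ∏ w ∈ primesAbove L v, (1 - x ^ w.asIdeal.inertiaDeg (𝓞 K)) := by
  have hpos : ∀ w ∈ primesAbove L v, 0 < w.asIdeal.inertiaDeg (𝓞 K) :=
    fun w _ ↦ inertiaDeg_pos_of_heightOne w
  have hsum := sum_inertiaDeg_primesAbove_le hLK v
  have hx1 : x ≤ 1 := by linarith
  have hge := prod_one_sub_pow_ge_of_eq_one hpos hsum hx0 hx1
  split_ifs with h3
  · have hb : ∀ y, |y| ≤ 1 → 1 - y * x ≤ 3 / 2 ∧ 0 ≤ 1 - y * x := by
      intro y hy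
      have := abs_le.mp ((abs_mul y x).trans_le (mul_le_mul hy (abs_of_nonneg hx0).le
        (abs_nonneg x) zero_le_one))
      constructor <;> linarith
    have hε1 : |ε| = 1 := by rcases hε with rfl | rfl <;> simp
    obtain ⟨h1, -⟩ := hb ε hε1.le
    obtain ⟨h2, h2'⟩ := hb (ε * chiThree (Ideal.absNorm v.asIdeal)) (by
      rw [abs_mul, hε1, one_mul]; exact abs_chiThree_le_one _)
    have := mul_le_mul h1 h2 h2' (by norm_num)
    nlinarith
  rw [one_mul]
  have h12 : Ideal.absNorm v.asIdeal % 3 = 1 ∨ Ideal.absNorm v.asIdeal % 3 = 2 := by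
    have := mt (three_mem_of_three_dvd_absNorm v) h3
    omega
  rcases h12 with h | h
  · have hχ : chiThree (Ideal.absNorm v.asIdeal) = 1 := by
      apply chiThree_of_eq_one
      have := (ZMod.natCast_eq_natCast_iff' _ 1 3).mpr h
      exact_mod_cast this
    obtain ⟨a, ha⟩ := exists_sq_add_self_add_one_mem v h
    obtain ⟨w, hw, hw1⟩ := (three_mem_or_exists_inertiaDeg_eq_one hLK hθ ha).resolve_left h3
    have hε1 : ε = 1 := by simpa [hw1] using hεL w hw
    rw [hχ, hε1]
    exact le_of_eq_of_le (by ring) hge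
  · have hχ : chiThree (Ideal.absNorm v.asIdeal) = -1 := by
      apply chiThree_of_eq_two
      have := (ZMod.natCast_eq_natCast_iff' _ 2 3).mpr h
      exact_mod_cast this
    have h2 : ∀ w ∈ primesAbove L v, w.asIdeal.inertiaDeg (𝓞 K) = 2 := by
      intro w hw
      have hle := (Finset.single_le_sum
        (fun w _ ↦ Nat.zero_le (w.asIdeal.inertiaDeg (𝓞 K))) hw).trans hsum
      have hne : w.asIdeal.inertiaDeg (𝓞 K) ≠ 1 := by
        intro hw1
        have hN := absNorm_of_mem_primesAbove hw
        rw [hw1, pow_one] at hN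
        have hw3 := three_mem_of_absNorm_mod_three_eq_two w (hN ▸ h) hθ
        refine h3 ?_
        rw [← under_asIdeal_of_mem hw, Ideal.mem_comap, map_ofNat]
        exact hw3
      have := hpos w hw
      omega
    refine le_of_eq_of_le ?_ (prod_one_sub_pow_ge_of_eq_two h2 hsum hx0 hx1)
    rw [hχ]
    rcases hε with rfl | rfl <;> ring

end LocalFactor

section EulerComparison
open IsDedekindDomain Module Filter Topology nonZeroDivisors

/-- A nonzero prime ideal, as an element of the monoid of nonzero ideals. -/
def nonzeroPrimeIdeal {R : Type*} [CommRing R] [IsDomain R] (v : HeightOneSpectrum R) :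
    (Ideal R)⁰ :=
  ⟨v.asIdeal, mem_nonZeroDivisors_of_ne_zero v.ne_bot⟩

theorem tendsto_prod_one_sub_mul_tsum_ideal {R : Type*} [CommRing R] [IsDedekindDomain R]
    (F : (Ideal R)⁰ →* ℝ) (hF : Summable F) {ι : Type*} {l : Filter ι}
    {S : ι → Finset (HeightOneSpectrum R)} (hS : ∀ v, ∀ᶠ i in l, v ∈ S i) :
    Tendsto (fun i ↦ (∏ v ∈ S i, (1 - F (nonzeroPrimeIdeal v))) * ∑' I, F I) l (𝓝 1) := by
  refine tendsto_prod_one_sub_mul_tsum F (fun v ↦ mul_right_injective _) (fun v I J h ↦ ?_)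
    (fun v w h ↦ ?_) (fun v h ↦ ?_) hF fun I hI ↦ ?_
  · rw [nonZeroDivisors_dvd_iff_dvd_coe] at h ⊢
    rw [nonZeroDivisors_dvd_iff_dvd_coe]
    exact v.prime.dvd_or_dvd h
  · rw [nonZeroDivisors_dvd_iff_dvd_coe] at h
    exact HeightOneSpectrum.ext
      (associated_iff_eq.mp ((v.prime.dvd_prime_iff_associated w.prime).mp h))
  · rw [nonZeroDivisors_dvd_iff_dvd_coe] at h
    exact v.prime.not_isUnit (isUnit_of_dvd_one h)
  · have hI' : (I : Ideal R) ≠ ⊤ := fun h ↦ hI (Subtype.ext (h.trans Ideal.one_eq_top.symm))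
    obtain ⟨M, hM, hIM⟩ := Ideal.exists_le_maximal _ hI'
    have hM0 : M ≠ ⊥ := fun h ↦ nonZeroDivisors.coe_ne_zero I (le_bot_iff.mp (h ▸ hIM))
    filter_upwards [hS ⟨M, hM.isPrime, hM0⟩] with i hi
    exact ⟨_, hi, nonZeroDivisors_dvd_iff_dvd_coe.mpr (Ideal.dvd_iff_le.mpr hIM)⟩

variable (K : Type*) [Field K] [NumberField K]

/-- The multiplicative function `I ↦ (N I) ^ (-s)` on nonzero ideals. -/
noncomputable def absNormRpow (s : ℝ) : (Ideal (𝓞 K))⁰ →* ℝ where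
  toFun I := (Ideal.absNorm (I : Ideal (𝓞 K)) : ℝ) ^ (-s)
  map_one' := by simp
  map_mul' I J := by
    rw [Submonoid.coe_mul, map_mul, Nat.cast_mul,
      Real.mul_rpow (Nat.cast_nonneg _) (Nat.cast_nonneg _)]

/-- The multiplicative function `I ↦ χ (N I)` on nonzero ideals, `χ` being the nontrivial
character modulo `3`. -/
noncomputable def chiThreeAbsNorm : (Ideal (𝓞 K))⁰ →* ℝ where
  toFun I := chiThree (Ideal.absNorm (I : Ideal (𝓞 K)))
  map_one' := by simp [chiThree_one]
  map_mul' I J := by rw [Submonoid.coe_mul, map_mul, Nat.cast_mul, chiThree_mul]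

variable {K}

theorem absNormRpow_apply (s : ℝ) (I : (Ideal (𝓞 K))⁰) :
    absNormRpow K s I = (Ideal.absNorm (I : Ideal (𝓞 K)) : ℝ) ^ (-s) := rfl

theorem absNormRpow_nonneg (s : ℝ) (I : (Ideal (𝓞 K))⁰) : 0 ≤ absNormRpow K s I :=
  Real.rpow_nonneg (Nat.cast_nonneg _) _

theorem summable_mul_absNormRpow {s : ℝ} (hs : 1 < s) {g : (Ideal (𝓞 K))⁰ →* ℝ}
    (hg : ∀ I, |g I| ≤ 1) : Summable (g * absNormRpow K s) := by
  refine (summable_absNorm_rpow K hs).of_norm_bounded fun I ↦ ?_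
  rw [MonoidHom.mul_apply, norm_mul, Real.norm_eq_abs, Real.norm_eq_abs,
    abs_of_nonneg (absNormRpow_nonneg s I)]
  exact mul_le_of_le_one_left (absNormRpow_nonneg s I) (hg I)

theorem absNormRpow_le_half {s : ℝ} (hs : 1 < s) (v : HeightOneSpectrum (𝓞 K)) :
    absNormRpow K s (nonzeroPrimeIdeal v) ≤ 1 / 2 := by
  have h2 : (2 : ℝ) ≤ Ideal.absNorm v.asIdeal := by exact_mod_cast one_lt_absNorm v
  have h1 : (1 : ℝ) ≤ Ideal.absNorm v.asIdeal := one_le_two.trans h2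
  calc absNormRpow K s (nonzeroPrimeIdeal v) ≤ (Ideal.absNorm v.asIdeal : ℝ) ^ (-1 : ℝ) :=
        Real.rpow_le_rpow_of_exponent_le h1 (by linarith)
    _ = (Ideal.absNorm v.asIdeal : ℝ)⁻¹ := Real.rpow_neg_one _
    _ ≤ 1 / 2 := by
        rw [one_div]
        exact inv_anti₀ two_pos h2

theorem absNormRpow_of_mem_primesAbove {L : Type*} [Field L] [NumberField L] [Algebra K L] (s : ℝ)
    {v : HeightOneSpectrum (𝓞 K)} {w : HeightOneSpectrum (𝓞 L)} (hw : w ∈ primesAbove L v) :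
    absNormRpow L s (nonzeroPrimeIdeal w) =
      absNormRpow K s (nonzeroPrimeIdeal v) ^ w.asIdeal.inertiaDeg (𝓞 K) := by
  have h := absNorm_of_mem_primesAbove hw
  simp only [absNormRpow_apply, nonzeroPrimeIdeal]
  rw [h, Nat.cast_pow, ← Real.rpow_natCast, ← Real.rpow_natCast,
    ← Real.rpow_mul (Nat.cast_nonneg _), ← Real.rpow_mul (Nat.cast_nonneg _), mul_comm]

theorem eventually_atTop_mem {α : Type*} (a : α) : ∀ᶠ S : Finset α in atTop, a ∈ S :=
  (eventually_ge_atTop {a}).mono fun _ h ↦ h (Finset.mem_singleton_self a)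

theorem mul_le_mul_of_tendsto_one {ι : Type*} {l : Filter ι} [l.NeBot] {A B C : ι → ℝ}
    {a b c k : ℝ} (hA : Tendsto (fun i ↦ A i * a) l (𝓝 1)) (hB : Tendsto (fun i ↦ B i * b) l (𝓝 1))
    (hC : Tendsto (fun i ↦ C i * c) l (𝓝 1)) (hB0 : ∀ i, 0 ≤ B i) (hC0 : ∀ i, 0 ≤ C i)
    (ha : 0 ≤ a) (h : ∀ i, k * (B i * C i) ≤ A i) : k * a ≤ b * c := by
  have hb : 0 ≤ b := by
    obtain ⟨i, hi⟩ := (hB.eventually (lt_mem_nhds one_pos)).exists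
    exact (pos_of_mul_pos_right hi (hB0 i)).le
  have hc : 0 ≤ c := by
    obtain ⟨i, hi⟩ := (hC.eventually (lt_mem_nhds one_pos)).exists
    exact (pos_of_mul_pos_right hi (hC0 i)).le
  have h1 : Tendsto (fun i ↦ k * a * ((B i * b) * (C i * c))) l (𝓝 (k * a * (1 * 1))) :=
    (hB.mul hC).const_mul _
  have h2 : Tendsto (fun i ↦ A i * a * (b * c)) l (𝓝 (1 * (b * c))) := hA.mul_const _
  have := le_of_tendsto_of_tendsto' h1 h2 fun i ↦ by
    calc k * a * ((B i * b) * (C i * c)) = k * (B i * C i) * (a * (b * c)) := by ring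
      _ ≤ A i * (a * (b * c)) := mul_le_mul_of_nonneg_right (h i) (by positivity)
      _ = A i * a * (b * c) := by ring
  linarith

open scoped Classical in
theorem exists_mul_tsum_le_mul [IsTotallyReal K] {L : Type*} [Field L] [NumberField L] [Algebra K L]
    (hLK : finrank K L = 2) {θ : 𝓞 L} (hθ : θ ^ 2 + θ + 1 = 0) {ψ : (Ideal (𝓞 K))⁰ →* ℝ}
    (hψ : ∀ I, ψ I = 1 ∨ ψ I = -1)
    (hψL : ∀ (I : Ideal (𝓞 L)) (J : (Ideal (𝓞 K))⁰), Ideal.relNorm (𝓞 K) I = J → ψ J = 1) :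
    ∃ c > 0, ∀ s > 1, c * ∑' I, absNormRpow L s I ≤
      (∑' I, (ψ * absNormRpow K s) I) * ∑' I, (ψ * chiThreeAbsNorm K * absNormRpow K s) I := by
  have hψ1 : ∀ I, |ψ I| = 1 := fun I ↦ by rcases hψ I with h | h <;> simp [h]
  have hψχ : ∀ I, |(ψ * chiThreeAbsNorm K) I| ≤ 1 := fun I ↦ by
    rw [MonoidHom.mul_apply, abs_mul, hψ1, one_mul]
    exact abs_chiThree_le_one _
  have hfin := finite_setOf_three_mem K
  refine ⟨(1 / 9) ^ hfin.toFinset.card, by positivity, fun s hs ↦ ?_⟩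
  have hA : Tendsto (fun S : Finset (HeightOneSpectrum (𝓞 K)) ↦
      (∏ v ∈ S, ∏ w ∈ primesAbove L v, (1 - absNormRpow L s (nonzeroPrimeIdeal w))) *
        ∑' I, absNormRpow L s I) atTop (𝓝 1) := by
    have h := tendsto_prod_one_sub_mul_tsum_ideal (absNormRpow L s) (summable_absNorm_rpow L hs)
      (l := atTop) (S := fun S : Finset (HeightOneSpectrum (𝓞 K)) ↦ S.biUnion (primesAbove L))
      fun w ↦ (eventually_atTop_mem (w.under (𝓞 K))).mono fun S hS ↦
        Finset.mem_biUnion.mpr ⟨_, hS, mem_primesAbove.mpr rfl⟩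
    refine h.congr fun S ↦ ?_
    rw [Finset.prod_biUnion]
    intro v _ v' _ hvv
    refine Finset.disjoint_left.mpr fun w hw hw' ↦ hvv ?_
    rw [← mem_primesAbove.mp hw, mem_primesAbove.mp hw']
  have hB := tendsto_prod_one_sub_mul_tsum_ideal (ψ * absNormRpow K s)
    (summable_mul_absNormRpow hs fun I ↦ (hψ1 I).le) eventually_atTop_mem
  have hC := tendsto_prod_one_sub_mul_tsum_ideal (ψ * chiThreeAbsNorm K * absNormRpow K s)
    (summable_mul_absNormRpow hs hψχ) eventually_atTop_mem
  have hfac : ∀ {g : (Ideal (𝓞 K))⁰ →* ℝ}, (∀ I, |g I| ≤ 1) → ∀ v : HeightOneSpectrum (𝓞 K),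
      0 ≤ 1 - (g * absNormRpow K s) (nonzeroPrimeIdeal v) := by
    intro g hg v
    have h1 := (mul_le_mul_of_nonneg_right (abs_le.mp (hg (nonzeroPrimeIdeal v))).2
      (absNormRpow_nonneg s (nonzeroPrimeIdeal v)))
    have h2 := absNormRpow_le_half hs v
    rw [MonoidHom.mul_apply]
    linarith
  refine mul_le_mul_of_tendsto_one hA hB hC (fun S ↦ Finset.prod_nonneg fun v _ ↦
    hfac (fun I ↦ (hψ1 I).le) v) (fun S ↦ Finset.prod_nonneg fun v _ ↦ hfac hψχ v)
    (tsum_nonneg (absNormRpow_nonneg s)) fun S ↦ ?_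
  have hc : (1 / 9 : ℝ) ^ hfin.toFinset.card ≤
      ∏ v ∈ S, if 3 ∈ v.asIdeal then 1 / 9 else 1 := by
    rw [Finset.prod_ite, Finset.prod_const, Finset.prod_const_one, mul_one]
    refine pow_le_pow_of_le_one (by norm_num) (by norm_num) (Finset.card_le_card fun v hv ↦ ?_)
    exact hfin.mem_toFinset.mpr (Finset.mem_filter.mp hv).2
  rw [← Finset.prod_mul_distrib]
  refine (mul_le_mul_of_nonneg_right hc (Finset.prod_nonneg fun v _ ↦
    mul_nonneg (hfac (fun I ↦ (hψ1 I).le) v) (hfac hψχ v))).trans ?_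
  rw [← Finset.prod_mul_distrib]
  refine Finset.prod_le_prod (fun v _ ↦ mul_nonneg (by split_ifs <;> norm_num)
    (mul_nonneg (hfac (fun I ↦ (hψ1 I).le) v) (hfac hψχ v))) fun v _ ↦ ?_
  rw [Finset.prod_congr rfl fun w hw ↦ by rw [absNormRpow_of_mem_primesAbove s hw]]
  refine local_factor_le hLK hθ v (hψ _) (fun w hw ↦ ?_) (absNormRpow_nonneg s _)
    (absNormRpow_le_half hs v)
  rw [← map_pow]
  exact hψL w.asIdeal _ (relNorm_of_mem_primesAbove hw)

end EulerComparison

section ClassGroupNorm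
open IsDedekindDomain Module Filter Topology nonZeroDivisors

variable {K L : Type*} [Field K] [NumberField K] [Field L] [NumberField L] [Algebra K L]

variable (K L) in
/-- The relative norm on nonzero ideals. -/
noncomputable def relNormNonzero : (Ideal (𝓞 L))⁰ →* (Ideal (𝓞 K))⁰ where
  toFun I := ⟨Ideal.relNorm (𝓞 K) (I : Ideal (𝓞 L)), mem_nonZeroDivisors_of_ne_zero
    (mt Ideal.relNorm_eq_bot_iff.mp (nonZeroDivisors.coe_ne_zero I))⟩
  map_one' := Subtype.ext (map_one _)
  map_mul' _ _ := Subtype.ext (map_mul _ _ _)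

theorem mk0_relNormNonzero_eq {I J : (Ideal (𝓞 L))⁰} (h : ClassGroup.mk0 I = ClassGroup.mk0 J) :
    ClassGroup.mk0 (relNormNonzero K L I) = ClassGroup.mk0 (relNormNonzero K L J) := by
  obtain ⟨x, y, hx, hy, hxy⟩ := ClassGroup.mk0_eq_mk0_iff.mp h
  refine ClassGroup.mk0_eq_mk0_iff.mpr ⟨Algebra.intNorm (𝓞 K) (𝓞 L) x,
    Algebra.intNorm (𝓞 K) (𝓞 L) y, Algebra.intNorm_ne_zero.mpr hx,
    Algebra.intNorm_ne_zero.mpr hy, ?_⟩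
  have := congrArg (Ideal.relNorm (𝓞 K)) hxy
  rwa [map_mul, map_mul, Ideal.relNorm_singleton, Ideal.relNorm_singleton] at this

variable (K L) in
/-- The norm homomorphism between class groups. -/
noncomputable def classGroupNorm : ClassGroup (𝓞 L) →* ClassGroup (𝓞 K) :=
  MonoidHom.mk' (fun C ↦ ClassGroup.mk0 (relNormNonzero K L (ClassGroup.mk0_surjective C).choose))
    fun C D ↦ by
      rw [← map_mul, ← map_mul]
      apply mk0_relNormNonzero_eq
      rw [map_mul, (ClassGroup.mk0_surjective _).choose_spec,
        (ClassGroup.mk0_surjective _).choose_spec, (ClassGroup.mk0_surjective _).choose_spec]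

theorem classGroupNorm_mk0 (I : (Ideal (𝓞 L))⁰) :
    classGroupNorm K L (ClassGroup.mk0 I) = ClassGroup.mk0 (relNormNonzero K L I) :=
  mk0_relNormNonzero_eq (ClassGroup.mk0_surjective _).choose_spec

theorem sq_mem_range_classGroupNorm (hLK : finrank K L = 2) (C : ClassGroup (𝓞 K)) :
    C ^ 2 ∈ (classGroupNorm K L).range := by
  obtain ⟨I, rfl⟩ := ClassGroup.mk0_surjective C
  have h0 : (I : Ideal (𝓞 K)).map (algebraMap (𝓞 K) (𝓞 L)) ≠ 0 := by
    intro h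
    refine nonZeroDivisors.coe_ne_zero I ?_
    exact (Ideal.map_eq_bot_iff_of_injective (FaithfulSMul.algebraMap_injective _ _)).mp h
  refine ⟨ClassGroup.mk0 ⟨_, mem_nonZeroDivisors_of_ne_zero h0⟩, ?_⟩
  rw [classGroupNorm_mk0, ← map_pow]
  exact congrArg ClassGroup.mk0 (Subtype.ext (relNorm_map_eq_sq hLK _))

theorem exists_monoidHom_real_of_ne_top {G : Type*} [CommGroup G] [Finite G] {H : Subgroup G}
    (hH : H ≠ ⊤) (h2 : ∀ g, g ^ 2 ∈ H) :
    ∃ ψ : G →* ℝ, (∀ g, ψ g = 1 ∨ ψ g = -1) ∧ (∀ g ∈ H, ψ g = 1) ∧ ψ ≠ 1 := by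
  obtain ⟨g, hg⟩ : ∃ g, g ∉ H := by
    by_contra! h
    exact hH ((Subgroup.eq_top_iff' H).mpr h)
  have hg1 : (g : G ⧸ H) ≠ 1 := mt (QuotientGroup.eq_one_iff g).mp hg
  have hexp : Monoid.exponent (G ⧸ H) = 2 := by
    have h : Monoid.exponent (G ⧸ H) ∣ 2 := by
      refine Monoid.exponent_dvd_of_forall_pow_eq_one fun q ↦ ?_
      obtain ⟨a, rfl⟩ := QuotientGroup.mk_surjective q
      exact (QuotientGroup.eq_one_iff _).mpr (h2 a)
    refine ((Nat.dvd_prime Nat.prime_two).mp h).resolve_left fun h1 ↦ hg1 ?_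
    simpa [h1] using Monoid.pow_exponent_eq_one (g : G ⧸ H)
  have : HasEnoughRootsOfUnity ℝ (Monoid.exponent (G ⧸ H)) := by
    rw [hexp]
    exact ⟨⟨-1, IsPrimitiveRoot.neg_one 0 two_ne_zero.symm⟩, inferInstance⟩
  obtain ⟨φ, hφ⟩ := CommGroup.exists_apply_ne_one_of_hasEnoughRootsOfUnity (G ⧸ H) ℝ hg1
  refine ⟨(Units.coeHom ℝ).comp (φ.comp (QuotientGroup.mk' H)), fun a ↦ ?_, fun a ha ↦ ?_, ?_⟩
  · rw [← sq_eq_one_iff, ← map_pow]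
    simp [(QuotientGroup.eq_one_iff _).mpr (h2 a)]
  · simp [(QuotientGroup.eq_one_iff a).mpr ha]
  · intro h
    exact hφ (Units.ext (DFunLike.congr_fun h g))

end ClassGroupNorm

section Limits
open Module Filter Topology nonZeroDivisors

variable {K : Type*} [Field K] [NumberField K]

theorem tsum_eq_sum_tsum_mk0_eq {f : (Ideal (𝓞 K))⁰ → ℝ} (hf : Summable f) :
    ∑' I, f I = ∑ C : ClassGroup (𝓞 K), ∑' I : {I // ClassGroup.mk0 I = C}, f I := by
  rw [← (Equiv.sigmaFiberEquiv ClassGroup.mk0).tsum_eq f, ← tsum_fintype (L := .unconditional _)]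
  exact Summable.tsum_sigma ((Equiv.sigmaFiberEquiv ClassGroup.mk0).summable_iff.mpr hf)

theorem tsum_character_mul_eq {ψ : ClassGroup (𝓞 K) →* ℝ} {f : (Ideal (𝓞 K))⁰ → ℝ}
    (hf : Summable fun I ↦ ψ (ClassGroup.mk0 I) * f I) :
    ∑' I, ψ (ClassGroup.mk0 I) * f I =
      ∑ C : ClassGroup (𝓞 K), ψ C * ∑' I : {I // ClassGroup.mk0 I = C}, f I := by
  rw [tsum_eq_sum_tsum_mk0_eq hf]
  refine Finset.sum_congr rfl fun C _ ↦ ?_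
  rw [← tsum_mul_left]
  exact tsum_congr fun I ↦ by rw [I.2]

theorem tendsto_sub_one_mul_tsum_character {ψ : ClassGroup (𝓞 K) →* ℝ} (hψ : ∀ C, |ψ C| ≤ 1)
    (hψ1 : ψ ≠ 1) :
    Tendsto (fun s ↦ (s - 1) * ∑' I, (ψ.comp ClassGroup.mk0 * absNormRpow K s) I) (𝓝[>] 1)
      (𝓝 0) := by
  obtain ⟨l, hl⟩ := exists_tendsto_sub_one_mul_tsum_mk0_eq K
  have h : Tendsto (fun s ↦ ∑ C, ψ C * ((s - 1) * ∑' I : {I // ClassGroup.mk0 I = C},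
      absNormRpow K s I)) (𝓝[>] 1) (𝓝 (∑ C, ψ C * l)) :=
    tendsto_finsetSum _ fun C _ ↦ (hl C).const_mul _
  rw [← Finset.sum_mul, sum_hom_units_eq_zero ψ hψ1, zero_mul] at h
  refine h.congr' ?_
  filter_upwards [self_mem_nhdsWithin] with s hs
  rw [tsum_congr fun I ↦ MonoidHom.mul_apply _ _ I]
  refine Eq.trans ?_ (congrArg ((s - 1) * ·) (tsum_character_mul_eq
    (summable_mul_absNormRpow hs (g := ψ.comp ClassGroup.mk0) fun I ↦ hψ _)).symm)
  simp only [Finset.mul_sum]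
  exact Finset.sum_congr rfl fun C _ ↦ by ring

theorem exists_bound_abs_tsum_character_chiThree [IsTotallyReal K] {ψ : ClassGroup (𝓞 K) →* ℝ}
    (hψ : ∀ C, |ψ C| ≤ 1) :
    ∃ D : ℝ, ∀ s ∈ Set.Ioc (1 : ℝ) 2,
      |∑' I, (ψ.comp ClassGroup.mk0 * chiThreeAbsNorm K * absNormRpow K s) I| ≤ D := by
  choose D hD using exists_bound_abs_tsum_chiThree_mk0_eq K
  refine ⟨∑ C, D C, fun s hs ↦ ?_⟩
  have hsum := summable_mul_absNormRpow hs.1 (g := ψ.comp ClassGroup.mk0 * chiThreeAbsNorm K)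
    fun I ↦ by
      rw [MonoidHom.mul_apply, abs_mul]
      exact mul_le_one₀ (hψ _) (abs_nonneg _) (abs_chiThree_le_one _)
  rw [mul_assoc] at hsum ⊢
  have h := tsum_character_mul_eq (f := chiThreeAbsNorm K * absNormRpow K s) hsum
  refine (congrArg abs h).trans_le ((Finset.abs_sum_le_sum_abs _ _).trans
    (Finset.sum_le_sum fun C _ ↦ ?_))
  rw [abs_mul]
  exact (mul_le_of_le_one_left (abs_nonneg _) (hψ C)).trans (hD C s hs)

end Limits

section Main
open Module Filter Topology nonZeroDivisors

theorem isTotallyReal_of_forall_exists_ofReal {K : Type*} [Field K]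
    (h : ∀ φ : K →+* ℂ, ∀ x : K, ∃ r : ℝ, φ x = (r : ℂ)) : IsTotallyReal K := by
  refine ⟨fun v ↦ InfinitePlace.isReal_iff.mpr ?_⟩
  refine ComplexEmbedding.isReal_iff.mpr (RingHom.ext fun x ↦ ?_)
  obtain ⟨r, hr⟩ := h v.embedding x
  rw [ComplexEmbedding.conjugate_coe_eq, hr, Complex.conj_ofReal]

variable {K L : Type*} [Field K] [NumberField K] [Field L] [NumberField L] [Algebra K L]

theorem classGroupNorm_surjective [IsTotallyReal K] (hLK : finrank K L = 2) {θ : 𝓞 L}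
    (hθ : θ ^ 2 + θ + 1 = 0) : Function.Surjective (classGroupNorm K L) := by
  rw [← MonoidHom.range_eq_top]
  by_contra hH
  obtain ⟨ψ, hψ, hψL, hψ1⟩ :=
    exists_monoidHom_real_of_ne_top hH (sq_mem_range_classGroupNorm hLK)
  have hψle : ∀ C, |ψ C| ≤ 1 := fun C ↦ by rcases hψ C with h | h <;> simp [h]
  obtain ⟨c, hc, hle⟩ := exists_mul_tsum_le_mul hLK hθ (ψ := ψ.comp ClassGroup.mk0)
    (fun I ↦ hψ _) fun I J hIJ ↦ by
      have hI : I ∈ (Ideal (𝓞 L))⁰ := by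
        refine mem_nonZeroDivisors_of_ne_zero fun h ↦ nonZeroDivisors.coe_ne_zero J ?_
        rw [← hIJ, h, map_zero]
      refine hψL _ ⟨ClassGroup.mk0 ⟨I, hI⟩, ?_⟩
      rw [classGroupNorm_mk0]
      exact congrArg ClassGroup.mk0 (Subtype.ext hIJ)
  obtain ⟨D, hD⟩ := exists_bound_abs_tsum_character_chiThree hψle
  have h0 := (tendsto_sub_one_mul_tsum_character hψle hψ1).abs.mul_const D
  have hL := (tendsto_sub_one_mul_tsum_absNorm_rpow L).const_mul c
  rw [abs_zero, zero_mul] at h0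
  have hmem : ∀ᶠ s : ℝ in 𝓝[>] 1, s ∈ Set.Ioc (1 : ℝ) 2 := Ioc_mem_nhdsGT one_lt_two
  refine (le_of_tendsto_of_tendsto hL h0 ?_).not_gt (mul_pos hc (dedekindZeta_residue_pos L))
  filter_upwards [hmem] with s hs
  have hs0 : 0 ≤ s - 1 := sub_nonneg.mpr hs.1.le
  calc c * ((s - 1) * ∑' I, absNormRpow L s I) = (s - 1) * (c * ∑' I, absNormRpow L s I) := by ring
    _ ≤ (s - 1) * ((∑' I, (ψ.comp ClassGroup.mk0 * absNormRpow K s) I) *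
        ∑' I, (ψ.comp ClassGroup.mk0 * chiThreeAbsNorm K * absNormRpow K s) I) :=
        mul_le_mul_of_nonneg_left (hle s hs.1) hs0
    _ = ((s - 1) * ∑' I, (ψ.comp ClassGroup.mk0 * absNormRpow K s) I) *
        ∑' I, (ψ.comp ClassGroup.mk0 * chiThreeAbsNorm K * absNormRpow K s) I := by ring
    _ ≤ _ := (le_abs_self _).trans (by
        rw [abs_mul]
        exact mul_le_mul_of_nonneg_left (hD s hs) (abs_nonneg _))

theorem exists_sq_add_self_add_one_eq_zero_of_sq_eq {s : L} (hs : s ^ 2 = -3) :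
    ∃ θ : 𝓞 L, θ ^ 2 + θ + 1 = 0 := by
  have h : ((s - 1) / 2) ^ 2 + (s - 1) / 2 + 1 = 0 := by linear_combination hs / 4
  have hint : IsIntegral ℤ ((s - 1) / 2) := by
    refine ⟨Polynomial.X ^ 2 + Polynomial.X + 1, by monicity!, ?_⟩
    simpa using h
  exact ⟨⟨_, hint⟩, RingOfIntegers.ext h⟩

end Main

/-- Let `K` be a totally real number field and `L = K(√-3)` a quadratic
extension of `K`. Then `h(K)` divides `h(L)`. -/
theorem classNumber_dvd_classNumber_of_sqrt_neg_three
    (K : Type) [Field K] [NumberField K]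
    (hKreal : ∀ φ : K →+* ℂ, ∀ x : K, ∃ r : ℝ, φ x = (r : ℂ))
    (L : Type) [Field L] [NumberField L] [Algebra K L]
    (hLK : Module.finrank K L = 2) (s : L) (hs : s ^ 2 = -3) :
    NumberField.classNumber K ∣ NumberField.classNumber L := by
  have := isTotallyReal_of_forall_exists_ofReal hKreal
  obtain ⟨θ, hθ⟩ := exists_sq_add_self_add_one_eq_zero_of_sq_eq hs
  rw [classNumber, classNumber, ← Nat.card_eq_fintype_card, ← Nat.card_eq_fintype_card]
  exact Subgroup.card_dvd_of_surjective _ (classGroupNorm_surjective hLK hθ)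
end

section
/- Let q be an odd rational prime, let K be a real quadratic number field (a totally real number field with [K : ℚ] = 2) in which q splits, i.e. the ideal q𝓞_K is the product of two distinct prime ideals of 𝓞_K, and let L be a quadratic extension of K containing an element s with s² = −q (so L = K(√−q)). Then the class number h(L) is even. -/
open NumberField

theorem exists_eq_sq_pow_or_eq_neg_sq_pow {R : Type*} [CommRing R] [IsDomain R]
    (h_neg : ∀ z : R, z ^ 2 ≠ -1) {n : ℕ} (hn : 0 < n) {x : R} (hx : x ^ n = 1) :
    ∃ k : ℕ, x = (x ^ k) ^ 2 ∨ x = -(x ^ k) ^ 2 := by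
  induction n using Nat.strong_induction_on with
  | _ n ih =>
    rcases Nat.even_or_odd' n with ⟨m, rfl | rfl⟩
    · rw [mul_comm, pow_mul, sq_eq_one_iff] at hx
      rcases hx with hx | hx
      · exact ih m (by lia) (by lia) hx
      · rcases Nat.even_or_odd' m with ⟨l, rfl | rfl⟩
        · exact absurd (by rw [← pow_mul, mul_comm, hx]) (h_neg (x ^ l))
        · exact ⟨l + 1, Or.inr (by linear_combination x * hx)⟩
    · exact ⟨m + 1, Or.inl (by linear_combination (-x) * hx)⟩

theorem Prime.sq_ne_mul_pow_of_odd {M : Type*} [CommMonoidWithZero M] [IsCancelMulZero M]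
    {p a b : M} (hp : Prime p) (ha : ¬ p ∣ a) {n : ℕ} (hn : Odd n) : b ^ 2 ≠ a * p ^ n := by
  intro h
  have h_mult := congrArg (emultiplicity p) h
  rw [emultiplicity_pow hp, emultiplicity_mul hp, emultiplicity_eq_zero.mpr ha, zero_add,
    emultiplicity_pow_self_of_prime hp] at h_mult
  have h_fin : emultiplicity p b ≠ ⊤ := by
    intro h_top
    rw [h_top] at h_mult
    exact absurd h_mult (by simp)
  lift emultiplicity p b to ℕ using h_fin with e
  norm_cast at h_mult
  exact (Nat.not_even_iff_odd.mpr hn) ⟨e, by lia⟩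

theorem Ideal.sup_span_singleton_sq_eq {R : Type*} [CommRing R] {I J : Ideal R} {s : R}
    (hIJ : I ⊔ J = ⊤) (hs : Ideal.span {s ^ 2} = I * J) : (I ⊔ Ideal.span {s}) ^ 2 = I := by
  have h : (I ⊔ Ideal.span {s}) ^ 2 = I * (I ⊔ J) ⊔ I * Ideal.span {s} := by
    rw [sq, Ideal.sup_mul, Ideal.mul_sup, Ideal.mul_sup, Ideal.span_singleton_mul_span_singleton,
      ← sq s, hs, mul_comm (Ideal.span {s}) I, Ideal.mul_sup, sup_assoc, ← sup_assoc (I * span {s}),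
      sup_idem, sup_comm (I * span {s}), sup_assoc]
  rw [h, hIJ, Ideal.mul_top]
  exact sup_eq_left.mpr Ideal.mul_le_left

namespace NumberField

theorem isTotallyComplex_of_sq_eq_neg_natCast {L : Type*} [Field L] {q : ℕ} (hq : 0 < q) {s : L}
    (hs : s ^ 2 = -(q : L)) : IsTotallyComplex L := by
  refine ⟨fun w ↦ ?_⟩
  rw [← InfinitePlace.not_isReal_iff_isComplex]
  intro hw
  have h := congrArg (InfinitePlace.embedding_of_isReal hw) hs
  simp only [map_pow, map_neg, map_natCast] at h
  have : (0 : ℝ) < q := by exact_mod_cast hq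
  nlinarith [sq_nonneg (InfinitePlace.embedding_of_isReal hw s)]

theorem IsTotallyReal.sq_ne_neg_natCast {K : Type*} [Field K] [NumberField K] [IsTotallyReal K]
    {q : ℕ} (hq : 0 < q) (x : K) : x ^ 2 ≠ -(q : K) := by
  intro hx
  have := isTotallyComplex_of_sq_eq_neg_natCast hq hx
  obtain ⟨w⟩ : Nonempty (InfinitePlace K) := inferInstance
  exact InfinitePlace.not_isReal_iff_isComplex.mpr (IsTotallyComplex.isComplex w)
    (IsTotallyReal.isReal w)

theorem IsCMField.exists_algebraMap_eq_of_complexConj_eq_self {K L : Type*} [Field K] [Field L]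
    [NumberField L] [IsTotallyReal K] [IsTotallyComplex L] [Algebra K L]
    [Algebra.IsQuadraticExtension K L] [IsCMField L] {x : 𝓞 L} (hx : complexConj L x = x) :
    ∃ y : 𝓞 K, algebraMap (𝓞 K) (𝓞 L) y = x := by
  rw [complexConj_eq_self_iff] at hx
  let y : K := (CMExtension.equivMaximalRealSubfield K L).symm ⟨x, hx⟩
  have hy : algebraMap K L y = x :=
    CMExtension.algebraMap_equivMaximalRealSubfield_symm_apply K L ⟨x, hx⟩
  have h_int : IsIntegral ℤ y :=
    (isIntegral_algebraMap_iff (algebraMap K L).injective).mp (hy ▸ x.isIntegral_coe)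
  exact ⟨⟨y, h_int⟩, RingOfIntegers.ext hy⟩

theorem IsCMField.map_complexConj_map_algebraMap {K L : Type*} [Field K] [Field L]
    [NumberField L] [IsTotallyReal K] [IsTotallyComplex L] [Algebra K L]
    [Algebra.IsQuadraticExtension K L] [IsCMField L] (I : Ideal (𝓞 K)) :
    (I.map (algebraMap (𝓞 K) (𝓞 L))).map (ringOfIntegersComplexConj L) =
      I.map (algebraMap (𝓞 K) (𝓞 L)) := by
  refine (Ideal.map_map _ (ringOfIntegersComplexConj L : 𝓞 L →+* 𝓞 L)).trans ?_
  congr 1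
  exact RingHom.ext fun y ↦ RingOfIntegers.ext ((complexConj_eq_self_iff L _).mpr
    (CMExtension.equivMaximalRealSubfield K L (y : K)).2)

theorem isPrincipal_pow_classNumber {K : Type*} [Field K] [NumberField K] (I : Ideal (𝓞 K)) :
    (I ^ classNumber K).IsPrincipal := by
  by_cases hI : I = 0
  · rw [hI, zero_pow (classNumber_ne_zero K)]
    exact bot_isPrincipal
  · have hI_mem := mem_nonZeroDivisors_of_ne_zero hI
    rw [← ClassGroup.mk0_eq_one_iff (pow_mem hI_mem _)]
    have h : ClassGroup.mk0 ⟨I, hI_mem⟩ ^ classNumber K = 1 := pow_card_eq_one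
    rw [← map_pow] at h
    exact h

theorem IsCMField.exists_pow_eq_one_of_mul_eq {L : Type*} [Field L] [NumberField L] [IsCMField L]
    {b u : 𝓞 L} (hb : b ≠ 0) (hu : complexConj L b = b * u) : ∃ n, 0 < n ∧ u ^ n = 1 := by
  have h_norm (φ : L →+* ℂ) : ‖φ u‖ = 1 := by
    have h := congrArg (fun x ↦ ‖φ x‖) hu
    simp only [complexEmbedding_complexConj, RCLike.norm_conj, map_mul, norm_mul] at h
    have hb' : ‖φ b‖ ≠ 0 := by simpa using hb
    exact (mul_eq_left₀ hb').mp h.symm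
  obtain ⟨n, hn, h⟩ := Embeddings.pow_eq_one_of_norm_eq_one L ℂ u.isIntegral_coe h_norm
  exact ⟨n, hn, RingOfIntegers.ext (by simpa using h)⟩

/-- Multiplying a generator of an ideal stable under complex conjugation by a suitable root of
unity makes it real or purely imaginary, provided that `-1` is not a square. -/
theorem IsCMField.exists_generator_complexConj_eq_or_eq_neg {L : Type*} [Field L] [NumberField L]
    [IsCMField L] (h_neg : ∀ z : 𝓞 L, z ^ 2 ≠ -1) {I : Ideal (𝓞 L)} (hI : I.IsPrincipal)
    (hI₀ : I ≠ ⊥) (hσ : I.map (ringOfIntegersComplexConj L) = I) :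
    ∃ c : 𝓞 L, I = Ideal.span {c} ∧ (complexConj L c = c ∨ complexConj L c = -c) := by
  obtain ⟨b, hb⟩ := hI
  rw [Ideal.submodule_span_eq] at hb
  have hb₀ : b ≠ 0 := by
    rintro rfl
    simp [hb] at hI₀
  let σ := ringOfIntegersComplexConj L
  have h_assoc : Associated b (σ b) := by
    rw [← Ideal.span_singleton_eq_span_singleton, ← hb]
    conv_lhs => rw [← hσ, hb, Ideal.map_span, Set.image_singleton]
  obtain ⟨u, hu⟩ := h_assoc
  have hσσ (x : 𝓞 L) : σ (σ x) = x := RingOfIntegers.ext (complexConj_apply_apply L x)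
  have hu_conj : (u : 𝓞 L) * σ u = 1 := by
    have h := hσσ b
    rw [← hu, map_mul, ← hu, mul_assoc] at h
    exact (mul_eq_left₀ hb₀).mp h
  obtain ⟨n, hn, hun⟩ := exists_pow_eq_one_of_mul_eq (u := (u : 𝓞 L)) hb₀
    (congrArg (algebraMap (𝓞 L) L) hu.symm)
  obtain ⟨k, hk⟩ := exists_eq_sq_pow_or_eq_neg_sq_pow h_neg hn hun
  have hk_conj : (u : 𝓞 L) ^ k * σ (u ^ k) = 1 := by rw [map_pow, ← mul_pow, hu_conj, one_pow]
  refine ⟨b * u ^ k, ?_, ?_⟩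
  · rw [hb, Ideal.span_singleton_eq_span_singleton]
    exact ⟨u ^ k, by simp⟩
  · have h_mul : σ (b * u ^ k) = b * u * σ (u ^ k) := by rw [map_mul, hu]
    refine hk.imp (fun h ↦ ?_) (fun h ↦ ?_)
    · have : σ (b * u ^ k) = b * u ^ k := by
        linear_combination h_mul + b * σ (u ^ k) * h + b * u ^ k * hk_conj
      exact congrArg (algebraMap (𝓞 L) L) this
    · have : σ (b * u ^ k) = -(b * u ^ k) := by
        linear_combination h_mul + b * σ (u ^ k) * h - b * u ^ k * hk_conj
      exact congrArg (algebraMap (𝓞 L) L) this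

end NumberField

/-- Let `q` be an odd prime and `K` a real quadratic field in which `q`
splits (i.e. `q𝓞 K` is the product of two distinct prime ideals), and let `L = K(√-q)`.
Then the class number of `L` is even. -/
theorem classNumber_even_of_split
    (q : ℕ) (hq : q.Prime) (hqodd : Odd q)
    (K : Type) [Field K] [NumberField K]
    (hKreal : ∀ φ : K →+* ℂ, ∀ x : K, ∃ r : ℝ, φ x = (r : ℂ))
    (hKdeg : Module.finrank ℚ K = 2)
    (hsplit : ∃ P Q : Ideal (𝓞 K), P.IsPrime ∧ Q.IsPrime ∧ P ≠ Q ∧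
      Ideal.span {(q : 𝓞 K)} = P * Q)
    (L : Type) [Field L] [NumberField L] [Algebra K L]
    (hLK : Module.finrank K L = 2) (s : L) (hs : s ^ 2 = -(q : L)) :
    Even (NumberField.classNumber L) := by
  have : IsTotallyReal K := by
    refine ⟨fun v ↦ InfinitePlace.isReal_iff.mpr (RingHom.ext fun x ↦ ?_)⟩
    obtain ⟨r, hr⟩ := hKreal v.embedding x
    rw [ComplexEmbedding.conjugate_coe_eq, hr, Complex.conj_ofReal]
  have : IsTotallyComplex L := isTotallyComplex_of_sq_eq_neg_natCast hq.pos hs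
  have : Algebra.IsQuadraticExtension K L := ⟨hLK⟩
  have : IsCMField L := IsCMField.ofCMExtension K L
  obtain ⟨P, Q, hP, hQ, hPQ, hq_eq⟩ := hsplit
  have hPQ₀ : P * Q ≠ 0 := by
    rw [← hq_eq]
    simpa using hq.ne_zero
  have hP_prime : Prime P := Ideal.prime_of_isPrime (left_ne_zero_of_mul hPQ₀) hP
  have hQ_prime : Prime Q := Ideal.prime_of_isPrime (right_ne_zero_of_mul hPQ₀) hQ
  have hP_max : P.IsMaximal := hP.isMaximal hP_prime.ne_zero
  have hQ_max : Q.IsMaximal := hQ.isMaximal hQ_prime.ne_zero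
  have hQP : ¬ Q ∣ P := fun h ↦ hPQ (hP_max.eq_of_le hQ_max.ne_top (Ideal.le_of_dvd h))
  let ι := algebraMap (𝓞 K) (𝓞 L)
  have hι : Function.Injective (Ideal.map ι) := Ideal.map_injective_of_faithfullyFlat
  obtain ⟨t, rfl⟩ : ∃ t : 𝓞 L, (t : L) = s :=
    ⟨⟨s, IsIntegral.of_pow two_pos (hs ▸ (isIntegral_natCast q).neg)⟩, rfl⟩
  have ht : t ^ 2 = -(q : 𝓞 L) := RingOfIntegers.ext (by simpa using hs)
  have hσt : IsCMField.complexConj L t = -t := by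
    have h_sq : IsCMField.complexConj L t ^ 2 = (t : L) ^ 2 := by
      rw [← map_pow, hs, map_neg, map_natCast]
    refine (sq_eq_sq_iff_eq_or_eq_neg.mp h_sq).resolve_left fun h ↦ ?_
    obtain ⟨y, hy⟩ := IsCMField.exists_algebraMap_eq_of_complexConj_eq_self (K := K) h
    refine IsTotallyReal.sq_ne_neg_natCast hq.pos (y : K) ?_
    have : y ^ 2 = -(q : 𝓞 K) :=
      FaithfulSMul.algebraMap_injective (𝓞 K) (𝓞 L) (by rw [map_pow, hy, ht]; simp)
    simpa using congrArg (algebraMap (𝓞 K) K) this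
  have ht_span : Ideal.span {t ^ 2} = P.map ι * Q.map ι := by
    rw [ht, Ideal.span_singleton_neg, ← Ideal.map_mul, ← hq_eq, Ideal.map_span,
      Set.image_singleton, map_natCast]
  -- An imaginary element times `t` is real, so it cannot generate a square root of `P ^ n`.
  have h_imag (x : 𝓞 L) (n : ℕ) (hx : IsCMField.complexConj L x = -x) :
      Ideal.span {x ^ 2} ≠ (P ^ n).map ι := by
    intro h
    obtain ⟨y, hy⟩ := IsCMField.exists_algebraMap_eq_of_complexConj_eq_self (K := K) (x := x * t)
      (by simp [hx, hσt])
    refine hQ_prime.sq_ne_mul_pow_of_odd (a := P ^ (n + 1)) (b := Ideal.span {y})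
      (mt hQ_prime.dvd_of_dvd_pow hQP) odd_one (hι ?_)
    rw [Ideal.span_singleton_pow, Ideal.map_span, Set.image_singleton, map_pow, hy, mul_pow,
      ← Ideal.span_singleton_mul_span_singleton, h, ht_span, ← Ideal.map_mul, ← Ideal.map_mul]
    ring_nf
  have h_real (x : 𝓞 L) (n : ℕ) (hn : Odd n) (hx : IsCMField.complexConj L x = x) :
      Ideal.span {x ^ 2} ≠ (P ^ n).map ι := by
    intro h
    obtain ⟨y, hy⟩ := IsCMField.exists_algebraMap_eq_of_complexConj_eq_self (K := K) hx
    refine hP_prime.sq_ne_mul_pow_of_odd (a := 1) (b := Ideal.span {y})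
      hP_prime.not_dvd_one hn (hι ?_)
    rw [Ideal.span_singleton_pow, Ideal.map_span, Set.image_singleton, map_pow, hy, h, one_mul]
  have h_neg (z : 𝓞 L) : z ^ 2 ≠ -1 := by
    intro hz
    have h_sq : IsCMField.complexConj L z ^ 2 = (z : L) ^ 2 := by
      rw [← map_pow, ← map_pow, hz]
      simp
    rcases sq_eq_sq_iff_eq_or_eq_neg.mp h_sq with h | h
    · obtain ⟨y, hy⟩ := IsCMField.exists_algebraMap_eq_of_complexConj_eq_self (K := K) h
      refine IsTotallyReal.sq_ne_neg_natCast one_pos (y : K) ?_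
      have : y ^ 2 = -1 :=
        FaithfulSMul.algebraMap_injective (𝓞 K) (𝓞 L) (by rw [map_pow, hy, hz]; simp)
      simpa using congrArg (algebraMap (𝓞 K) K) this
    · exact h_imag z 0 h (by simp [hz, Ideal.span_singleton_neg, Ideal.one_eq_top, Ideal.map_top])
  let R : Ideal (𝓞 L) := P.map ι ⊔ Ideal.span {t}
  have hR_sq : R ^ 2 = P.map ι := by
    refine Ideal.sup_span_singleton_sq_eq ?_ ht_span
    rw [← Ideal.map_sup, Ideal.IsMaximal.coprime_of_ne hP_max hQ_max hPQ, Ideal.map_top]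
  have hR₀ : R ≠ 0 := by
    intro h
    refine hP_prime.ne_zero (hι ?_)
    rw [← hR_sq, h]
    simp
  have hR_conj : R.map (IsCMField.ringOfIntegersComplexConj L) = R := by
    rw [Ideal.map_sup, IsCMField.map_complexConj_map_algebraMap, Ideal.map_span,
      Set.image_singleton, show IsCMField.ringOfIntegersComplexConj L t = -t from
        RingOfIntegers.ext hσt, Ideal.span_singleton_neg]
  by_contra h_odd
  rw [Nat.not_even_iff_odd] at h_odd
  obtain ⟨c, hc, hc_conj⟩ := IsCMField.exists_generator_complexConj_eq_or_eq_neg h_neg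
    (isPrincipal_pow_classNumber R) (pow_ne_zero _ hR₀) (by rw [Ideal.map_pow, hR_conj])
  have hc_sq : Ideal.span {c ^ 2} = (P ^ classNumber L).map ι := by
    rw [← Ideal.span_singleton_pow, ← hc, pow_right_comm, hR_sq, Ideal.map_pow]
  exact hc_conj.elim (fun h ↦ h_real c _ h_odd h hc_sq) fun h ↦ h_imag c _ h hc_sq
end

section
/- Let n be a positive integer and let K = ℚ(ζ_{3^n})⁺ be the maximal totally real subfield of the 3^n-th cyclotomic field. Then 2 is inert in K; that is, the ideal of 𝓞_K generated by 2 is a prime ideal. -/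
open NumberField

/-- An integer is prime in the ring of integers of a number field `K` as soon as it is prime in
the ring of integers of an extension of `K`. -/
theorem NumberField.prime_of_prime_algebraMap {K L : Type*} [Field K] [NumberField K] [Field L]
    [NumberField L] [Algebra K L] {a : 𝓞 K} (ha : Prime (algebraMap (𝓞 K) (𝓞 L) a)) :
    Prime a := by
  have hinj : Function.Injective (algebraMap (𝓞 K) (𝓞 L)) :=
    FaithfulSMul.algebraMap_injective _ _
  have ha0 : a ≠ 0 := by
    rintro rfl
    exact ha.ne_zero (map_zero _)
  have hdvd : ∀ x : 𝓞 K, algebraMap (𝓞 K) (𝓞 L) a ∣ algebraMap (𝓞 K) (𝓞 L) x → a ∣ x := by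
    rintro x ⟨y, hy⟩
    have haK : (a : K) ≠ 0 := by simpa using ha0
    have hy' : algebraMap K L (x : K) = algebraMap K L (a : K) * (y : L) :=
      congrArg (algebraMap (𝓞 L) L) hy
    have hquot : algebraMap K L ((x : K) / a) = y := by
      rw [map_div₀, hy', mul_div_cancel_left₀ _ (by simpa using ha0)]
    have hint : IsIntegral ℤ ((x : K) / a) := by
      rw [← isIntegral_algebraMap_iff (algebraMap K L).injective, hquot]
      exact y.isIntegral_coe
    refine ⟨⟨_, hint⟩, RingOfIntegers.ext ?_⟩
    exact (mul_div_cancel₀ (x : K) haK).symm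
  refine ⟨ha0, fun h ↦ ha.not_isUnit (h.map _), fun x y hxy ↦ ?_⟩
  have := map_dvd (algebraMap (𝓞 K) (𝓞 L)) hxy
  rw [map_mul] at this
  exact (ha.dvd_or_dvd this).imp (hdvd x) (hdvd y)

/-- If a prime `p` is a primitive root modulo `m`, then it is inert in the `m`-th cyclotomic
field. -/
theorem IsCyclotomicExtension.Rat.prime_natCast_of_orderOf_eq_totient (m p : ℕ) [NeZero m]
    [hp : Fact p.Prime] (L : Type*) [Field L] [NumberField L] [IsCyclotomicExtension {m} ℚ L]
    (hm : ¬ p ∣ m) (hord : orderOf (p : ZMod m) = m.totient) : Prime (p : 𝓞 L) := by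
  have hp0 : (p : 𝓞 L) ≠ 0 := by exact_mod_cast hp.out.ne_zero
  have hbot : Ideal.span {(p : ℤ)} ≠ ⊥ := by simpa using hp.out.ne_zero
  have : (Ideal.span {(p : ℤ)}).IsPrime := by
    rw [Ideal.span_singleton_prime (by exact_mod_cast hp.out.ne_zero)]
    exact Nat.prime_iff_prime_int.mp hp.out
  have : (Ideal.span {(p : ℤ)}).IsMaximal := this.isMaximal hbot
  obtain ⟨⟨P, hP, hPp⟩⟩ := (Ideal.span {(p : ℤ)}).nonempty_primesOver (S := 𝓞 L)
  have : P.IsMaximal := .of_liesOver_isMaximal P (Ideal.span {(p : ℤ)})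
  have hle : Ideal.span {(p : 𝓞 L)} ≤ P := by
    rw [Ideal.span_singleton_le_iff_mem]
    have := (Ideal.mem_of_liesOver P (Ideal.span {(p : ℤ)}) p).mp
      (Ideal.mem_span_singleton_self _)
    simpa using this
  have hnorm : Ideal.absNorm P = Ideal.absNorm (Ideal.span {(p : 𝓞 L)}) := by
    rw [Ideal.absNorm_eq_pow_inertiaDeg' P hp.out, Ideal.absNorm_span_natCast,
      RingOfIntegers.rank, IsCyclotomicExtension.finrank (n := m) L
        (Polynomial.cyclotomic.irreducible_rat (NeZero.pos m)), ← hord,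
      ← IsCyclotomicExtension.Rat.inertiaDeg_eq_of_not_dvd p L P hm]
    rw [Ideal.inertiaDeg'_eq_inertiaDeg]
  have hP0 : Ideal.absNorm P ≠ 0 := by
    rw [hnorm, Ideal.absNorm_span_natCast]
    exact pow_ne_zero _ hp.out.ne_zero
  obtain ⟨Q, hQ⟩ := Ideal.dvd_iff_le.mpr hle
  have hQ1 : Ideal.absNorm Q = 1 := by
    rw [hQ, map_mul] at hnorm
    exact (mul_eq_left₀ hP0).mp hnorm.symm
  rw [Ideal.absNorm_eq_one_iff.mp hQ1, Ideal.mul_top] at hQ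
  rwa [← Ideal.span_singleton_prime hp0, hQ]

/-- The number `2` is a primitive root modulo every power of `3`. -/
theorem ZMod.orderOf_two_three_pow (k : ℕ) :
    orderOf (2 : ZMod (3 ^ (k + 1))) = (3 ^ (k + 1)).totient := by
  have h4 : orderOf ((2 : ZMod (3 ^ (k + 1))) ^ 2) = 3 ^ k := by
    rw [← ZMod.orderOf_one_add_prime Nat.prime_three (by norm_num) k]
    norm_num
  have h2 : 2 ∣ orderOf (2 : ZMod (3 ^ (k + 1))) := by
    have h := orderOf_map_dvd
      (ZMod.castHom (dvd_pow_self 3 k.succ_ne_zero) (ZMod 3) : ZMod (3 ^ (k + 1)) →* ZMod 3) 2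
    have h3 : orderOf (2 : ZMod 3) = 2 := orderOf_eq_prime (by decide) (by decide)
    rwa [MonoidHom.coe_coe, map_ofNat, h3] at h
  rw [orderOf_pow_of_dvd two_ne_zero h2] at h4
  rw [Nat.totient_prime_pow_succ Nat.prime_three, ← h4]
  exact (Nat.div_mul_cancel h2).symm

/-- For every positive integer `n`, the rational prime `2` is inert in the
maximal totally real subfield `ℚ(ζ_{3^n})⁺ = ℚ(ζ + ζ⁻¹)` of the `3^n`-th cyclotomic field:
the ideal generated by `2` in its ring of integers is prime. -/
theorem two_inert_in_real_cyclotomic (n : ℕ) (hn : 0 < n)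
    (ζ : ℂ) (hζ : IsPrimitiveRoot ζ (3 ^ n)) :
    (Ideal.span {(2 : 𝓞 ↥(IntermediateField.adjoin ℚ {ζ + ζ⁻¹}))}).IsPrime := by
  obtain ⟨k, rfl⟩ := Nat.exists_eq_succ_of_ne_zero hn.ne'
  have : IsCyclotomicExtension {3 ^ (k + 1)} ℚ (IntermediateField.adjoin ℚ {ζ}) :=
    (IntermediateField.isCyclotomicExtension_singleton_iff_eq_adjoin _ _ _ _ hζ).mpr rfl
  have : NumberField (IntermediateField.adjoin ℚ {ζ}) :=
    IsCyclotomicExtension.numberField {3 ^ (k + 1)} ℚ _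
  have hle : IntermediateField.adjoin ℚ {ζ + ζ⁻¹} ≤ IntermediateField.adjoin ℚ {ζ} := by
    have hmem := IntermediateField.mem_adjoin_simple_self ℚ ζ
    rw [IntermediateField.adjoin_simple_le_iff]
    exact add_mem hmem (inv_mem hmem)
  let _ : Algebra (IntermediateField.adjoin ℚ {ζ + ζ⁻¹}) (IntermediateField.adjoin ℚ {ζ}) :=
    (IntermediateField.inclusion hle).toRingHom.toAlgebra
  have : NumberField (IntermediateField.adjoin ℚ {ζ + ζ⁻¹}) :=
    { to_charZero := inferInstance
      to_finiteDimensional := .of_injective (IntermediateField.inclusion hle).toLinearMap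
        (IntermediateField.inclusion_injective hle) }
  have htwo : Prime (2 : 𝓞 (IntermediateField.adjoin ℚ {ζ})) := by
    refine mod_cast IsCyclotomicExtension.Rat.prime_natCast_of_orderOf_eq_totient
      (3 ^ (k + 1)) 2 _ ?_ ?_
    · exact fun h ↦ by simpa using Nat.prime_two.dvd_of_dvd_pow h
    · exact mod_cast ZMod.orderOf_two_three_pow k
  have hprime : Prime (2 : 𝓞 (IntermediateField.adjoin ℚ {ζ + ζ⁻¹})) := by
    apply NumberField.prime_of_prime_algebraMap (L := IntermediateField.adjoin ℚ {ζ})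
    rwa [map_ofNat]
  exact (Ideal.span_singleton_prime hprime.ne_zero).mpr hprime
end
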